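/- Assume the Section 3 setup, with u the least nonnegative integer such that the tangent cone of F_{t-1} contains a monomial X^{2^u}Y^ℓ for some ℓ. Then n_1 + n_2 + ... + n_t = d - 2^u, and for any monomial X^k Y^{d-i} occurring in F with nonzero coefficient, its image in F_{t+2} under the composite exponent maps (a,b) ↦ (a, a·t + b - (d - 2^u)) (from F to F_t), then (a,b) ↦ (a + b - (2^u - 2), b) (from F_t to F_{t+1}), then (a,b) ↦ (a, (2^{u-1} - 2)·a + b - (2^u - 4)) (from F_{t+1} to F_{t+2}) is the monomial X^r Y^s, where r = k(t+1) - i + 2 and s = k(2^{u-1}(t+1) - t - 2) - i(2^{u-1} - 1) + 2^u. -/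

import Mathlib

open MvPolynomial

noncomputable section

/-- The smallest total degree of a monomial occurring in `P`. -/
def minMonomialDeg {K : Type*} [Field K] (P : MvPolynomial (Fin 2) K) : ℕ :=
  sInf {m : ℕ | ∃ s ∈ P.support, (s.sum fun _ e => e) = m}

/-- The tangent cone of `P` at the origin: the nonzero homogeneous component of
lowest total degree (for `P ≠ 0`). -/
def tangentCone {K : Type*} [Field K] (P : MvPolynomial (Fin 2) K) : MvPolynomial (Fin 2) K :=
  homogeneousComponent (minMonomialDeg P) P

section LowDegree

variable {k : Type*} [Field k]

/-- Bivariate polynomials of total degree at most `n`. -/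
def lowDeg (k : Type*) [Field k] (n : ℕ) : Submodule k (Polynomial (Polynomial k)) where
  carrier := {P | ∀ i j, n < i + j → (P.coeff j).coeff i = 0}
  add_mem' {P Q} hP hQ i j h := by
    simp [hP i j h, hQ i j h]
  zero_mem' i j _ := by simp
  smul_mem' c P hP i j h := by
    simp [Polynomial.coeff_smul, hP i j h]

theorem mem_lowDeg {n : ℕ} {P : Polynomial (Polynomial k)} :
    P ∈ lowDeg k n ↔ ∀ i j, n < i + j → (P.coeff j).coeff i = 0 := Iff.rfl

theorem mem_lowDeg_iff_degree {n : ℕ} {P : Polynomial (Polynomial k)} :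
    P ∈ lowDeg k n ↔ ∀ j, (P.coeff j).degree < ((n + 1 - j : ℕ) : WithBot ℕ) := by
  simp only [mem_lowDeg, Polynomial.degree_lt_iff_coeff_zero]
  exact ⟨fun h j i hi => h i j (by omega), fun h i j hij => h j i (by omega)⟩

theorem lowDeg_mono {m n : ℕ} (h : m ≤ n) : lowDeg k m ≤ lowDeg k n :=
  fun _ hP i j hij => hP i j (by omega)

theorem coeff_eq_zero_of_mem_lowDeg {n j : ℕ} {P : Polynomial (Polynomial k)}
    (hP : P ∈ lowDeg k n) (hj : n < j) : P.coeff j = 0 := by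
  ext i
  exact hP i j (by omega)

theorem natDegree_le_of_mem_lowDeg {n : ℕ} {P : Polynomial (Polynomial k)}
    (hP : P ∈ lowDeg k n) : P.natDegree ≤ n :=
  Polynomial.natDegree_le_iff_coeff_eq_zero.2 fun _ hj => coeff_eq_zero_of_mem_lowDeg hP hj

theorem mul_mem_lowDeg {m n : ℕ} {P Q : Polynomial (Polynomial k)}
    (hP : P ∈ lowDeg k m) (hQ : Q ∈ lowDeg k n) : P * Q ∈ lowDeg k (m + n) := by
  intro i j hij
  rw [Polynomial.coeff_mul, Polynomial.finsetSum_coeff]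
  refine Finset.sum_eq_zero fun p hp => ?_
  rw [Polynomial.coeff_mul]
  refine Finset.sum_eq_zero fun r hr => ?_
  rw [Finset.HasAntidiagonal.mem_antidiagonal] at hp hr
  by_cases h : m < r.1 + p.1
  · rw [hP _ _ h, zero_mul]
  · rw [hQ r.2 p.2 (by omega), mul_zero]

theorem C_C_mem_lowDeg (a : k) (n : ℕ) : Polynomial.C (Polynomial.C a) ∈ lowDeg k n := by
  intro i j hij
  rw [Polynomial.coeff_C]
  split_ifs with h
  · rw [Polynomial.coeff_C, if_neg (by omega)]
  · simp

theorem one_mem_lowDeg (n : ℕ) : (1 : Polynomial (Polynomial k)) ∈ lowDeg k n := by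
  simpa using C_C_mem_lowDeg (1 : k) n

theorem C_mem_lowDeg {p : Polynomial k} {n : ℕ} (h : p.natDegree ≤ n) :
    Polynomial.C p ∈ lowDeg k n := by
  intro i j hij
  rw [Polynomial.coeff_C]
  split_ifs with h0
  · exact Polynomial.coeff_eq_zero_of_natDegree_lt (by omega)
  · simp

theorem C_X_mem_lowDeg : Polynomial.C (Polynomial.X : Polynomial k) ∈ lowDeg k 1 :=
  C_mem_lowDeg Polynomial.natDegree_X_le

theorem X_pow_mem_lowDeg (n : ℕ) :
    (Polynomial.X ^ n : Polynomial (Polynomial k)) ∈ lowDeg k n := by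
  intro i j hij
  rw [Polynomial.coeff_X_pow]
  split_ifs with h0
  · rw [Polynomial.coeff_one, if_neg (by omega)]
  · simp

theorem X_mem_lowDeg : (Polynomial.X : Polynomial (Polynomial k)) ∈ lowDeg k 1 := by
  simpa using X_pow_mem_lowDeg (k := k) 1

theorem pow_mem_lowDeg {m : ℕ} {P : Polynomial (Polynomial k)} (hP : P ∈ lowDeg k m) (n : ℕ) :
    P ^ n ∈ lowDeg k (m * n) := by
  induction n with
  | zero => simpa using one_mem_lowDeg 0
  | succ n ih => rw [pow_succ, Nat.mul_succ]; exact mul_mem_lowDeg ih hP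

/-- A linear map sends polynomials of low degree into any submodule that contains the images of
the monomials of low degree. -/
theorem map_mem_of_mem_lowDeg {M : Type*} [AddCommGroup M] [Module k M]
    (L : Polynomial (Polynomial k) →ₗ[k] M) (S : Submodule k M) {n : ℕ}
    (h : ∀ i j, i + j ≤ n → L (Polynomial.C (Polynomial.X ^ i) * Polynomial.X ^ j) ∈ S)
    {P : Polynomial (Polynomial k)} (hP : P ∈ lowDeg k n) : L P ∈ S := by
  have key : P = ∑ j ∈ P.support, ∑ i ∈ (P.coeff j).support,
      (P.coeff j).coeff i • (Polynomial.C (Polynomial.X ^ i) * Polynomial.X ^ j) := by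
    conv_lhs => rw [P.as_sum_support_C_mul_X_pow]
    refine Finset.sum_congr rfl fun j _ => ?_
    conv_lhs => rw [(P.coeff j).as_sum_support_C_mul_X_pow]
    rw [map_sum, Finset.sum_mul]
    refine Finset.sum_congr rfl fun i _ => ?_
    rw [← smul_mul_assoc, Polynomial.smul_C, Polynomial.smul_eq_C_mul]
  rw [key, map_sum]
  refine Submodule.sum_mem _ fun j _ => ?_
  rw [map_sum]
  refine Submodule.sum_mem _ fun i hi => ?_
  rw [map_smul]
  refine Submodule.smul_mem _ _ (h i j ?_)
  by_contra hc
  exact Polynomial.mem_support_iff.1 hi (hP i j (by omega))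

end LowDegree

section Values

variable {k : Type*} [Field k] {O : Type*} [CommRing O] [Algebra k O]

/-- The values of polynomials of total degree at most `n` under an algebra homomorphism. -/
def lowDegValues (φ : Polynomial (Polynomial k) →ₐ[k] O) (n : ℕ) : Submodule k O :=
  (lowDeg k n).map φ.toLinearMap

theorem map_mem_lowDegValues (φ : Polynomial (Polynomial k) →ₐ[k] O) {n : ℕ}
    {P : Polynomial (Polynomial k)} (hP : P ∈ lowDeg k n) : φ P ∈ lowDegValues φ n :=
  ⟨P, hP, rfl⟩

variable {φ : Polynomial (Polynomial k) →ₐ[k] O}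

theorem lowDegValues_mono {m n : ℕ} (h : m ≤ n) : lowDegValues φ m ≤ lowDegValues φ n :=
  Submodule.map_mono (lowDeg_mono h)

theorem mul_mem_lowDegValues {m n : ℕ} {a b : O} (ha : a ∈ lowDegValues φ m)
    (hb : b ∈ lowDegValues φ n) : a * b ∈ lowDegValues φ (m + n) := by
  obtain ⟨P, hP, rfl⟩ := ha
  obtain ⟨Q, hQ, rfl⟩ := hb
  exact ⟨P * Q, mul_mem_lowDeg hP hQ, map_mul φ P Q⟩

theorem one_mem_lowDegValues (n : ℕ) : (1 : O) ∈ lowDegValues φ n :=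
  ⟨1, one_mem_lowDeg n, map_one φ⟩

theorem pow_mem_lowDegValues {m : ℕ} {a : O} (ha : a ∈ lowDegValues φ m) (n : ℕ) :
    a ^ n ∈ lowDegValues φ (m * n) := by
  obtain ⟨P, hP, rfl⟩ := ha
  exact ⟨P ^ n, pow_mem_lowDeg hP n, map_pow φ P n⟩

/-- Division with remainder by a monic polynomial whose total degree is its degree in the outer
variable does not raise the total degree. -/
theorem exists_reduction {M : Polynomial (Polynomial k)} {D : ℕ} (hM : M.Monic)
    (hMD : M.natDegree = D) (hMl : M ∈ lowDeg k D) (n : ℕ) (P : Polynomial (Polynomial k))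
    (hP : P ∈ lowDeg k n) :
    ∃ R ∈ lowDeg k n, R.degree < D ∧ M ∣ P - R := by
  suffices H : ∀ (N : ℕ) (P : Polynomial (Polynomial k)), P.natDegree < N → P ∈ lowDeg k n →
      ∃ R ∈ lowDeg k n, R.degree < D ∧ M ∣ P - R from H _ P (Nat.lt_succ_self _) hP
  intro N
  induction N with
  | zero => intro P h; omega
  | succ N ih =>
    intro P hN hP
    by_cases hd : P.degree < D
    · exact ⟨P, hP, hd, by simp⟩
    have hP0 : P ≠ 0 := by
      rintro rfl
      exact hd (by simp)
    have hdeg : M.degree ≤ P.degree := by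
      rw [Polynomial.degree_eq_natDegree hM.ne_zero, hMD]; exact not_lt.1 hd
    have hDP : D ≤ P.natDegree := by
      rw [← hMD]; exact Polynomial.natDegree_le_natDegree hdeg
    have hPn := natDegree_le_of_mem_lowDeg hP
    set S : Polynomial (Polynomial k) :=
      Polynomial.C P.leadingCoeff * Polynomial.X ^ (P.natDegree - D) with hS
    have hSl : S ∈ lowDeg k (n - D) := by
      have h1 : P.leadingCoeff.natDegree ≤ n - P.natDegree := by
        rw [Polynomial.natDegree_le_iff_coeff_eq_zero]
        intro i hi
        exact hP i _ (by omega)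
      have := mul_mem_lowDeg (C_mem_lowDeg h1) (X_pow_mem_lowDeg (k := k) (P.natDegree - D))
      exact lowDeg_mono (by omega) this
    have hlow : P - M * S ∈ lowDeg k n :=
      Submodule.sub_mem _ hP (lowDeg_mono (by omega) (mul_mem_lowDeg hMl hSl))
    by_cases hz : P - M * S = 0
    · exact ⟨0, Submodule.zero_mem _, by simp, S,
         by rw [sub_zero]; exact sub_eq_zero.1 hz⟩
    have hlt : (P - M * S).degree < P.degree := by
      have := Polynomial.div_wf_lemma ⟨hdeg, hP0⟩ hM
      rwa [hMD] at this
    obtain ⟨R, hR, hRd, T, hT⟩ := ih (P - M * S)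
      (lt_of_lt_of_le (Polynomial.natDegree_lt_natDegree hz hlt) (by omega)) hlow
    exact ⟨R, hR, hRd, S + T, by rw [mul_add, ← hT]; ring⟩

/-- The polynomial with prescribed coefficients of bounded degrees. -/
def polyOfCoeffs (k : Type*) [Field k] (D n : ℕ) :
    ((j : Fin D) → Polynomial.degreeLT k (n + 1 - j)) →ₗ[k] Polynomial (Polynomial k) :=
  ∑ j : Fin D, (Polynomial.monomial (j : ℕ)).restrictScalars k ∘ₗ
    (Polynomial.degreeLT k (n + 1 - j)).subtype ∘ₗ LinearMap.proj j

theorem polyOfCoeffs_apply (D n : ℕ) (c : (j : Fin D) → Polynomial.degreeLT k (n + 1 - j)) :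
    polyOfCoeffs k D n c = ∑ j : Fin D, Polynomial.monomial (j : ℕ) (c j : Polynomial k) := by
  simp [polyOfCoeffs]

theorem coeff_polyOfCoeffs (D n : ℕ) (c : (j : Fin D) → Polynomial.degreeLT k (n + 1 - j))
    (i : ℕ) : (polyOfCoeffs k D n c).coeff i = if h : i < D then (c ⟨i, h⟩ : Polynomial k) else 0 := by
  rw [polyOfCoeffs_apply, Polynomial.finsetSum_coeff]
  simp only [Polynomial.coeff_monomial]
  split_ifs with h
  · rw [Finset.sum_eq_single (⟨i, h⟩ : Fin D)]
    · simp
    · intro b _ hb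
      rw [if_neg]
      intro hbi
      exact hb (Fin.ext hbi)
    · simp
  · refine Finset.sum_eq_zero fun b _ => if_neg ?_
    have := b.2
    omega

theorem finrank_lowDegValues {M : Polynomial (Polynomial k)} {D : ℕ} (hM : M.Monic)
    (hMD : M.natDegree = D) (hMl : M ∈ lowDeg k D) (hker : ∀ P, φ P = 0 ↔ M ∣ P) (n : ℕ) :
    Module.finrank k (lowDegValues φ n) = ∑ j ∈ Finset.range D, (n + 1 - j) := by
  have hrange : LinearMap.range (φ.toLinearMap ∘ₗ polyOfCoeffs k D n) = lowDegValues φ n := by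
    apply le_antisymm
    · rintro _ ⟨c, rfl⟩
      refine ⟨polyOfCoeffs k D n c, ?_, rfl⟩
      rw [SetLike.mem_coe, mem_lowDeg_iff_degree]
      intro j
      rw [coeff_polyOfCoeffs]
      split_ifs with h
      · exact Polynomial.mem_degreeLT.1 (c ⟨j, h⟩).2
      · simp
    · rintro _ ⟨P, hP, rfl⟩
      obtain ⟨R, hR, hRd, hdvd⟩ := exists_reduction hM hMD hMl n P hP
      refine ⟨fun j => ⟨R.coeff j, Polynomial.mem_degreeLT.2 (mem_lowDeg_iff_degree.1 hR j)⟩, ?_⟩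
      have h1 : polyOfCoeffs k D n (fun j => ⟨R.coeff j, Polynomial.mem_degreeLT.2
          (mem_lowDeg_iff_degree.1 hR j)⟩) = R := by
        ext1 i
        rw [coeff_polyOfCoeffs]
        split_ifs with h
        · rfl
        · rw [Polynomial.coeff_eq_zero_of_degree_lt]
          exact lt_of_lt_of_le hRd (by exact_mod_cast not_lt.1 h)
      have h2 := (hker _).2 hdvd
      rw [map_sub, sub_eq_zero] at h2
      simp only [LinearMap.comp_apply, h1]
      exact h2.symm
  have hinj : Function.Injective (φ.toLinearMap ∘ₗ polyOfCoeffs k D n) := by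
    rw [← LinearMap.ker_eq_bot, LinearMap.ker_eq_bot']
    intro c hc
    have h1 : M ∣ polyOfCoeffs k D n c := (hker _).1 hc
    have h2 : polyOfCoeffs k D n c = 0 := by
      refine Polynomial.eq_zero_of_dvd_of_degree_lt h1 ?_
      rw [Polynomial.degree_eq_natDegree hM.ne_zero, hMD, Polynomial.degree_lt_iff_coeff_zero]
      intro j hj
      rw [coeff_polyOfCoeffs, dif_neg (by omega)]
    ext1 j
    have h3 := coeff_polyOfCoeffs D n c j
    rw [h2, dif_pos j.2] at h3
    exact Subtype.ext h3.symm
  rw [← hrange, LinearMap.finrank_range_of_inj hinj, Module.finrank_pi_fintype]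
  rw [Finset.sum_range]
  refine Finset.sum_congr rfl fun j _ => ?_
  rw [(Polynomial.degreeLTEquiv k (n + 1 - j)).finrank_eq]
  simp

instance finite_lowDegValues (n : ℕ) : Module.Finite k (lowDegValues φ n) := by
  have : Module.Finite k (lowDeg k n) := by
    let e : lowDeg k n →ₗ[k] ((j : Fin (n + 1)) → Polynomial.degreeLT k (n + 1 - j)) :=
      { toFun := fun P j => ⟨P.1.coeff j, Polynomial.mem_degreeLT.2
          (mem_lowDeg_iff_degree.1 P.2 j)⟩
        map_add' := fun P Q => by ext1 j; simp
        map_smul' := fun a P => by ext1 j; simp }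
    refine Module.Finite.of_injective e ?_
    intro P Q h
    apply Subtype.ext
    ext1 j
    by_cases hj : j < n + 1
    · exact congrArg Subtype.val (congrFun h ⟨j, hj⟩)
    · rw [coeff_eq_zero_of_mem_lowDeg P.2 (by omega), coeff_eq_zero_of_mem_lowDeg Q.2 (by omega)]
  exact Module.Finite.map _ _

end Values

section Order

variable {k : Type*} [Field k]

theorem order_le_of_mem_lowDegValues {φ : Polynomial (Polynomial k) →ₐ[k] PowerSeries k}
    (hφ : φ Polynomial.X = PowerSeries.X) {M : Polynomial (Polynomial k)} {D : ℕ} (hM : M.Monic)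
    (hMD : M.natDegree = D) (hMl : M ∈ lowDeg k D) (hker : ∀ P, φ P = 0 ↔ M ∣ P)
    {γ r : ℕ} {s : PowerSeries k} (hs : s ∈ lowDegValues φ γ) (hs0 : s ≠ 0)
    (hr : PowerSeries.X ^ r ∣ s) : r ≤ D * γ := by
  set p := D + r with hp
  let L : (lowDegValues φ p × (Fin r → k)) →ₗ[k] PowerSeries k :=
    (LinearMap.mulRight k s ∘ₗ (lowDegValues φ p).subtype).coprod
      (Fintype.linearCombination k fun j : Fin r => (PowerSeries.X : PowerSeries k) ^ (j : ℕ))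
  have hL : ∀ a c, L (a, c) = (a : PowerSeries k) * s +
      ∑ j : Fin r, c j • (PowerSeries.X : PowerSeries k) ^ (j : ℕ) := by
    intro a c
    simp [L, Fintype.linearCombination_apply]
  have hLmem : ∀ v, L v ∈ lowDegValues φ (p + γ) := by
    rintro ⟨a, c⟩
    rw [hL]
    refine Submodule.add_mem _ (mul_mem_lowDegValues a.2 hs)
      (Submodule.sum_mem _ fun j _ => Submodule.smul_mem _ _ ?_)
    have h1 : φ (Polynomial.X ^ (j : ℕ)) ∈ lowDegValues φ (p + γ) :=
      map_mem_lowDegValues φ (lowDeg_mono (by omega) (X_pow_mem_lowDeg (j : ℕ)))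
    rwa [map_pow, hφ] at h1
  have hinj : Function.Injective (L.codRestrict _ hLmem) := by
    rw [← LinearMap.ker_eq_bot, LinearMap.ker_eq_bot']
    rintro ⟨a, c⟩ h
    have h0 : L (a, c) = 0 := congrArg Subtype.val h
    rw [hL] at h0
    have hc : c = 0 := by
      funext i
      have h1 := congrArg (PowerSeries.coeff (i : ℕ)) h0
      rw [map_add, map_sum, PowerSeries.X_pow_dvd_iff.1 (hr.mul_left _) _ i.2, zero_add,
        map_zero, Finset.sum_eq_single i] at h1
      · simpa [PowerSeries.coeff_X_pow] using h1
      · intro j _ hj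
        rw [map_smul, PowerSeries.coeff_X_pow, if_neg fun h => hj (Fin.ext h.symm), smul_zero]
      · simp
    subst hc
    have h2 : (a : PowerSeries k) * s = 0 := by simpa using h0
    have h3 : a = 0 := Subtype.ext ((mul_eq_zero.1 h2).resolve_right hs0)
    rw [h3]; rfl
  have hrank := LinearMap.finrank_le_finrank_of_injective hinj
  rw [Module.finrank_prod, finrank_lowDegValues hM hMD hMl hker,
    finrank_lowDegValues hM hMD hMl hker, Module.finrank_fin_fun] at hrank
  have hsum : ∑ j ∈ Finset.range D, (p + γ + 1 - j) =
      ∑ j ∈ Finset.range D, (p + 1 - j) + D * γ := by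
    rw [show D * γ = ∑ _j ∈ Finset.range D, γ by simp, ← Finset.sum_add_distrib]
    refine Finset.sum_congr rfl fun j hj => ?_
    have := Finset.mem_range.1 hj
    omega
  omega

end Order

section FrobeniusIndependence

variable {k : Type*} [Field k] [Fintype k]

theorem eq_zero_of_sum_mul_pow_card_eq_zero {ι : Type*} [Fintype ι] {b : ι → PowerSeries k}
    (hb : LinearIndependent k b)
    (hord : ∀ c : ι → k, PowerSeries.X ^ Fintype.card k ∣ ∑ j, c j • b j → ∑ j, c j • b j = 0)
    {w : ι → PowerSeries k} (h : ∑ j, b j * w j ^ Fintype.card k = 0) : w = 0 := by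
  set q := Fintype.card k with hq
  have hq0 : q ≠ 0 := Fintype.card_ne_zero
  have key : ∀ N j, PowerSeries.X ^ N ∣ w j := by
    intro N
    induction N with
    | zero => simp
    | succ N ih =>
      choose v hv using ih
      have h1 : ∑ j, b j * v j ^ q = 0 := by
        have h2 : (PowerSeries.X ^ N) ^ q * ∑ j, b j * v j ^ q = 0 := by
          rw [← h, Finset.mul_sum]
          refine Finset.sum_congr rfl fun j _ => ?_
          rw [hv j, mul_pow]; ring
        exact (mul_eq_zero.1 h2).resolve_left (pow_ne_zero _ (pow_ne_zero _ PowerSeries.X_ne_zero))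
      have hvc : ∀ j, ∃ z, v j ^ q = PowerSeries.C (PowerSeries.constantCoeff (v j)) +
          PowerSeries.X ^ q * z := by
        intro j
        obtain ⟨z, hz⟩ : PowerSeries.X ∣ v j - PowerSeries.C (PowerSeries.constantCoeff (v j)) := by
          rw [PowerSeries.X_dvd_iff]; simp
        refine ⟨z ^ q, ?_⟩
        have h3 := congrArg (FiniteField.frobeniusAlgHom k (PowerSeries k)) (sub_eq_iff_eq_add'.1 hz)
        simp only [map_add, FiniteField.coe_frobeniusAlgHom] at h3
        rw [← hq] at h3
        rw [h3, mul_pow, ← map_pow, hq, FiniteField.pow_card]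
      choose z hz using hvc
      have h4 : ∑ j, PowerSeries.constantCoeff (v j) • b j = PowerSeries.X ^ q *
          -∑ j, b j * z j := by
        have h5 : ∑ j, b j * v j ^ q = ∑ j, PowerSeries.constantCoeff (v j) • b j +
            PowerSeries.X ^ q * ∑ j, b j * z j := by
          rw [Finset.mul_sum, ← Finset.sum_add_distrib]
          refine Finset.sum_congr rfl fun j _ => ?_
          rw [hz, PowerSeries.smul_eq_C_mul]; ring
        rw [h1] at h5
        rw [mul_neg, eq_neg_iff_add_eq_zero, ← h5]
      have h6 := hord _ ⟨_, h4⟩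
      have h7 := Fintype.linearIndependent_iff.1 hb _ h6
      intro j
      rw [hv j, pow_succ]
      exact mul_dvd_mul_left _ (PowerSeries.X_dvd_iff.2 (h7 j))
  funext j
  ext n
  exact PowerSeries.X_pow_dvd_iff.1 (key (n + 1) j) n (Nat.lt_succ_self n)

variable {V : Submodule k (PowerSeries k)} [Module.Finite k V]

theorem sum_repr_smul_eq_zero (hV : ∀ s ∈ V, PowerSeries.X ^ Fintype.card k ∣ s → s = 0)
    {ι : Type*} (S : Finset ι) (s : ι → V) (w : ι → PowerSeries k)
    (h : ∑ j ∈ S, (s j : PowerSeries k) * w j ^ Fintype.card k = 0)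
    (r : Fin (Module.finrank k V)) :
    ∑ j ∈ S, (Module.finBasis k V).repr (s j) r • w j = 0 := by
  set b := Module.finBasis k V
  have hb : LinearIndependent k fun r => (b r : PowerSeries k) :=
    b.linearIndependent.map' V.subtype (Submodule.ker_subtype V)
  refine congrFun (eq_zero_of_sum_mul_pow_card_eq_zero hb (fun c hc => hV _ ?_ hc)
    (w := fun r => ∑ j ∈ S, b.repr (s j) r • w j) ?_) r
  · exact Submodule.sum_mem _ fun j _ => Submodule.smul_mem _ _ (b j).2
  · have h1 : ∀ r, (∑ j ∈ S, b.repr (s j) r • w j) ^ Fintype.card k =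
        ∑ j ∈ S, b.repr (s j) r • w j ^ Fintype.card k := by
      intro r
      have := map_sum (FiniteField.frobeniusAlgHom k (PowerSeries k))
        (fun j => b.repr (s j) r • w j) S
      simpa only [map_smul, FiniteField.coe_frobeniusAlgHom] using this
    simp only [h1, Finset.mul_sum]
    rw [Finset.sum_comm, ← h]
    refine Finset.sum_congr rfl fun j _ => ?_
    conv_rhs => rw [← b.sum_repr (s j)]
    rw [Submodule.coe_sum, Finset.sum_mul]
    refine Finset.sum_congr rfl fun r _ => ?_
    simp

theorem sum_mul_eq_zero_of_sum_mul_pow_card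
    (hV : ∀ s ∈ V, PowerSeries.X ^ Fintype.card k ∣ s → s = 0)
    {ι : Type*} (S : Finset ι) (s : ι → PowerSeries k) (hs : ∀ j, s j ∈ V)
    (w : ι → PowerSeries k) (h : ∑ j ∈ S, s j * w j ^ Fintype.card k = 0) :
    ∑ j ∈ S, s j * w j = 0 := by
  have h1 := sum_repr_smul_eq_zero hV S (fun j => ⟨s j, hs j⟩) w h
  set b := Module.finBasis k V
  have h2 : ∀ j, s j = ∑ r, b.repr ⟨s j, hs j⟩ r • (b r : PowerSeries k) := by
    intro j
    have := congrArg Subtype.val (b.sum_repr ⟨s j, hs j⟩)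
    rw [Submodule.coe_sum] at this
    exact this.symm
  calc ∑ j ∈ S, s j * w j = ∑ j ∈ S, ∑ r, (b r : PowerSeries k) *
        (b.repr ⟨s j, hs j⟩ r • w j) := by
        refine Finset.sum_congr rfl fun j _ => ?_
        conv_lhs => rw [h2 j]
        rw [Finset.sum_mul]
        refine Finset.sum_congr rfl fun r _ => ?_
        simp
    _ = 0 := by
        rw [Finset.sum_comm]
        refine Finset.sum_eq_zero fun r _ => ?_
        rw [← Finset.mul_sum, h1 r, mul_zero]

theorem eq_zero_of_sum_mul_pow_card_of_linearIndependent
    (hV : ∀ s ∈ V, PowerSeries.X ^ Fintype.card k ∣ s → s = 0)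
    {ι : Type*} [Fintype ι] (s : ι → V) {w : ι → PowerSeries k} (hw : LinearIndependent k w)
    (h : ∑ j, (s j : PowerSeries k) * w j ^ Fintype.card k = 0) : s = 0 := by
  funext j
  apply (Module.finBasis k V).repr.injective
  ext r
  have := Fintype.linearIndependent_iff.1 hw _ (sum_repr_smul_eq_zero hV Finset.univ s w h r) j
  simpa using this

end FrobeniusIndependence

section WeightedDegree

variable {k : Type*} [Field k]

theorem algHom_monomial_monomial {A : Type*} [Semiring A] [Algebra k A]
    (φ : Polynomial (Polynomial k) →ₐ[k] A) (i j : ℕ) (c : k) :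
    φ (Polynomial.monomial j (Polynomial.monomial i c)) =
      c • (φ (Polynomial.C Polynomial.X) ^ i * φ Polynomial.X ^ j) := by
  rw [← map_pow φ, ← map_pow φ, ← map_mul φ, ← map_smul φ]
  congr 1
  rw [← Polynomial.C_mul_X_pow_eq_monomial, ← Polynomial.C_mul_X_pow_eq_monomial,
    ← smul_mul_assoc, ← map_pow, Polynomial.smul_C, Polynomial.smul_eq_C_mul]

/-- The homogenisation-type substitution `X ↦ X T`, `Y ↦ Y T`. -/
def scaleHom (k : Type*) [Field k] :
    Polynomial (Polynomial k) →ₐ[k] Polynomial (Polynomial (Polynomial k)) :=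
  Polynomial.aevalAeval (A := Polynomial (Polynomial (Polynomial k)))
    (Polynomial.C (Polynomial.C Polynomial.X) * Polynomial.X)
    (Polynomial.C Polynomial.X * Polynomial.X)

theorem coeff_scaleHom (P : Polynomial (Polynomial k)) (n i j : ℕ) :
    (((scaleHom k P).coeff n).coeff j).coeff i = if i + j = n then (P.coeff j).coeff i else 0 := by
  induction P using Polynomial.induction_on' with
  | add P Q hP hQ =>
    simp only [map_add, Polynomial.coeff_add, hP, hQ]
    split_ifs <;> simp
  | monomial b p =>
    induction p using Polynomial.induction_on' with
    | add p r hp hr =>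
      simp only [map_add, Polynomial.coeff_add, hp, hr]
      split_ifs <;> simp
    | monomial a c =>
      have h : scaleHom k (Polynomial.monomial b (Polynomial.monomial a c)) =
          Polynomial.monomial (a + b) (Polynomial.monomial b (Polynomial.monomial a c)) := by
        rw [algHom_monomial_monomial, scaleHom, Polynomial.aevalAeval_X, Polynomial.aevalAeval_Y]
        simp only [← Polynomial.C_mul_X_pow_eq_monomial, Algebra.smul_def,
          Polynomial.algebraMap_apply, map_mul, map_pow]
        simp only [Algebra.algebraMap_self, RingHom.id_apply]
        ring
      rw [h]
      have hz : i + j ≠ a + b →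
          ((Polynomial.monomial b (Polynomial.monomial a c)).coeff j).coeff i = 0 := by
        intro hne
        rw [Polynomial.coeff_monomial]
        split_ifs with hb
        · rw [Polynomial.coeff_monomial, if_neg (by omega)]
        · simp
      rw [Polynomial.coeff_monomial]
      by_cases h1 : a + b = n
      · rw [if_pos h1]
        split_ifs with h2
        · rfl
        · exact hz (by omega)
      · rw [if_neg h1]
        split_ifs with h2
        · rw [hz (by omega)]; simp
        · simp

theorem natDegree_scaleHom_le_iff {P : Polynomial (Polynomial k)} {n : ℕ} :
    (scaleHom k P).natDegree ≤ n ↔ P ∈ lowDeg k n := by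
  rw [Polynomial.natDegree_le_iff_coeff_eq_zero]
  constructor
  · intro h i j hij
    have h1 := coeff_scaleHom P (i + j) i j
    rw [h _ hij, if_pos rfl] at h1
    simpa using h1.symm
  · intro h m hm
    ext j i
    rw [coeff_scaleHom]
    split_ifs with h1
    · simpa using h i j (by omega)
    · simp

theorem mem_lowDeg_of_monic_mul {M H : Polynomial (Polynomial k)} {N : ℕ} (hM : M.Monic)
    (hMH : (M * H).Monic) (hdeg : (M * H).natDegree = N) (hlow : M * H ∈ lowDeg k N) :
    M ∈ lowDeg k M.natDegree := by
  have hH : H.Monic := hM.of_mul_monic_left hMH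
  have hle : ∀ {P : Polynomial (Polynomial k)}, P.Monic →
      P.natDegree ≤ (scaleHom k P).natDegree := by
    intro P hP
    have h1 := coeff_scaleHom P P.natDegree 0 P.natDegree
    rw [if_pos (zero_add _), hP.coeff_natDegree] at h1
    refine Polynomial.le_natDegree_of_ne_zero fun h0 => ?_
    rw [h0] at h1
    simp at h1
  have h0 : ∀ {P : Polynomial (Polynomial k)}, P.Monic → scaleHom k P ≠ 0 := by
    intro P hP h
    have h1 := coeff_scaleHom P P.natDegree 0 P.natDegree
    rw [if_pos (zero_add _), hP.coeff_natDegree, h] at h1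
    simp at h1
  have h1 := natDegree_scaleHom_le_iff.2 hlow
  rw [map_mul, Polynomial.natDegree_mul (h0 hM) (h0 hH)] at h1
  have h2 := hM.natDegree_mul hH
  have h3 := hle hM
  have h4 := hle hH
  exact natDegree_scaleHom_le_iff.1 (by omega)

end WeightedDegree

section MinimalEquation

variable {k : Type*} [Field k] {O : Type*} [CommRing O] [IsDomain O] [Algebra k O]

theorem exists_minimal_equation (φ : Polynomial (Polynomial k) →ₐ[k] O)
    (hinj : ∀ p : Polynomial k, φ (Polynomial.C p) = 0 → p = 0)
    {F : Polynomial (Polynomial k)} {N : ℕ} (hF : F.Monic) (hFN : F.natDegree = N)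
    (hFl : F ∈ lowDeg k N) (hF0 : φ F = 0) :
    ∃ M : Polynomial (Polynomial k), M.Monic ∧ M ∈ lowDeg k M.natDegree ∧
      (∀ P, φ P = 0 ↔ M ∣ P) ∧ M ∣ F ∧ M.natDegree ≤ N ∧ 1 ≤ M.natDegree := by
  let _ : Algebra (Polynomial k) O := (φ.toRingHom.comp Polynomial.C).toAlgebra
  have hφ : ∀ P, Polynomial.aeval (φ Polynomial.X) P = φ P := by
    intro P
    induction P using Polynomial.induction_on' with
    | add P Q hP hQ => simp only [map_add, hP, hQ]
    | monomial n p =>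
      rw [Polynomial.aeval_monomial, ← Polynomial.C_mul_X_pow_eq_monomial, map_mul, map_pow]
      rfl
  have : FaithfulSMul (Polynomial k) O := by
    rw [faithfulSMul_iff_algebraMap_injective, injective_iff_map_eq_zero]
    exact hinj
  have hXint : IsIntegral (Polynomial k) (φ Polynomial.X) :=
    ⟨F, hF, by rw [← Polynomial.aeval_def, hφ, hF0]⟩
  set M := minpoly (Polynomial k) (φ Polynomial.X)
  have hker : ∀ P, φ P = 0 ↔ M ∣ P := by
    intro P
    rw [← hφ]
    exact minpoly.isIntegrallyClosed_dvd_iff hXint P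
  have hM : M.Monic := minpoly.monic hXint
  obtain ⟨H, hH⟩ := (hker F).1 hF0
  refine ⟨M, hM, mem_lowDeg_of_monic_mul (N := N) hM (hH ▸ hF) (hH ▸ hFN) (hH ▸ hFl), hker,
    ⟨H, hH⟩, ?_, ?_⟩
  · rw [← hFN]
    exact Polynomial.natDegree_le_of_dvd ⟨H, hH⟩ hF.ne_zero
  · exact minpoly.natDegree_pos hXint

end MinimalEquation

section Separability

variable {k : Type*} [Field k]

/-- Partial derivative in the inner variable. -/
def derivX (k : Type*) [Field k] : Polynomial (Polynomial k) →ₗ[k] Polynomial (Polynomial k) :=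
  Polynomial.lsum fun j => (Polynomial.monomial j).restrictScalars k ∘ₗ Polynomial.derivative

theorem derivX_monomial (j : ℕ) (p : Polynomial k) :
    derivX k (Polynomial.monomial j p) = Polynomial.monomial j (Polynomial.derivative p) := by
  simp [derivX, Polynomial.lsum_apply, Polynomial.sum_monomial_index]

theorem coeff_derivX (P : Polynomial (Polynomial k)) (j : ℕ) :
    (derivX k P).coeff j = Polynomial.derivative (P.coeff j) := by
  induction P using Polynomial.induction_on' with
  | add P Q hP hQ => simp only [map_add, Polynomial.coeff_add, hP, hQ]
  | monomial n p =>
    rw [derivX_monomial, Polynomial.coeff_monomial, Polynomial.coeff_monomial]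
    split_ifs <;> simp

theorem derivX_mem_lowDeg {n : ℕ} {P : Polynomial (Polynomial k)} (hP : P ∈ lowDeg k n) :
    derivX k P ∈ lowDeg k (n - 1) := by
  intro i j hij
  rw [coeff_derivX, Polynomial.coeff_derivative, hP _ _ (by omega), zero_mul]

theorem derivative_mem_lowDeg {n : ℕ} {P : Polynomial (Polynomial k)} (hP : P ∈ lowDeg k n) :
    Polynomial.derivative P ∈ lowDeg k (n - 1) := by
  intro i j hij
  rw [Polynomial.coeff_derivative, ← Nat.cast_succ, ← nsmul_eq_mul', Polynomial.coeff_smul,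
    hP _ _ (by omega), smul_zero]

theorem derivative_algHom_apply (φ : Polynomial (Polynomial k) →ₐ[k] PowerSeries k)
    (hφ : φ Polynomial.X = PowerSeries.X) (P : Polynomial (Polynomial k)) :
    PowerSeries.derivative k (φ P) = φ (derivX k P) *
      PowerSeries.derivative k (φ (Polynomial.C Polynomial.X)) +
      φ (Polynomial.derivative P) := by
  induction P using Polynomial.induction_on' with
  | add P Q hP hQ => simp only [map_add, hP, hQ]; ring
  | monomial j p =>
    induction p using Polynomial.induction_on' with
    | add p r hp hr => simp only [map_add, hp, hr]; ring
    | monomial i c =>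
      rw [derivX_monomial, Polynomial.derivative_monomial, Polynomial.derivative_monomial,
        ← nsmul_eq_mul', ← nsmul_eq_mul', map_nsmul, map_nsmul, map_nsmul, map_nsmul, map_nsmul,
        algHom_monomial_monomial, algHom_monomial_monomial, algHom_monomial_monomial, Derivation.map_smul,
        hφ, Derivation.leibniz,
        Derivation.leibniz_pow, Derivation.leibniz_pow]
      simp only [smul_eq_mul, nsmul_eq_mul, PowerSeries.smul_eq_C_mul]
      have : PowerSeries.derivative k (PowerSeries.X : PowerSeries k) = 1 := by
        simp
      rw [this]
      ring

theorem exists_pow_eq_of_derivatives_eq_zero [Finite k] (p : ℕ) [Fact p.Prime] [CharP k p]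
    {P : Polynomial (Polynomial k)} (hX : derivX k P = 0) (hY : Polynomial.derivative P = 0) :
    ∃ H, P = H ^ p := by
  have hp : p ≠ 0 := (Fact.out : p.Prime).ne_zero
  have h1 : ∀ c : Polynomial k, Polynomial.derivative c = 0 → ∃ h, c = h ^ p := by
    intro c hc
    have hsurj : Function.Surjective (frobenius k p) :=
      Finite.surjective_of_injective (frobenius_inj k p)
    obtain ⟨g, hg⟩ := Polynomial.map_surjective _ hsurj (Polynomial.contract p c)
    refine ⟨g, ?_⟩
    rw [← Polynomial.expand_contract p hc hp, ← hg, ← Polynomial.map_expand,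
      Polynomial.map_frobenius_expand]
  set Q := Polynomial.contract p P
  have hQ : Polynomial.expand _ p Q = P := Polynomial.expand_contract p hY hp
  have h2 : ∀ n, ∃ h, Q.coeff n = h ^ p := by
    intro n
    apply h1
    rw [Polynomial.coeff_contract hp, ← coeff_derivX, hX, Polynomial.coeff_zero]
  choose h hh using h2
  refine ⟨∑ n ∈ Q.support, Polynomial.C (h n) * Polynomial.X ^ n, ?_⟩
  rw [sum_pow_char, ← hQ]
  conv_lhs => rw [Q.as_sum_support_C_mul_X_pow]
  rw [map_sum]
  refine Finset.sum_congr rfl fun n _ => ?_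
  rw [map_mul, map_pow, Polynomial.expand_C, Polynomial.expand_X, hh, map_pow, mul_pow]
  ring

theorem algHom_derivative_ne_zero [Finite k] (p : ℕ) [Fact p.Prime] [CharP k p]
    (φ : Polynomial (Polynomial k) →ₐ[k] PowerSeries k) (hφ : φ Polynomial.X = PowerSeries.X)
    (hx : PowerSeries.derivative k (φ (Polynomial.C Polynomial.X)) ≠ 0)
    {M : Polynomial (Polynomial k)} (hM : M.Monic) (hker : ∀ P, φ P = 0 ↔ M ∣ P)
    (hD : 1 ≤ M.natDegree) : φ (Polynomial.derivative M) ≠ 0 := by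
  intro h
  have hdeg : ∀ P : Polynomial (Polynomial k), (∀ j, M.natDegree ≤ j → P.coeff j = 0) →
      φ P = 0 → P = 0 := by
    intro P hP h0
    refine Polynomial.eq_zero_of_dvd_of_degree_lt ((hker _).1 h0) ?_
    rw [Polynomial.degree_eq_natDegree hM.ne_zero, Polynomial.degree_lt_iff_coeff_zero]
    exact hP
  have hY : Polynomial.derivative M = 0 := by
    refine hdeg _ (fun j hj => ?_) h
    rw [Polynomial.coeff_derivative, Polynomial.coeff_eq_zero_of_natDegree_lt (by omega), zero_mul]
  have hX : derivX k M = 0 := by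
    refine hdeg _ (fun j hj => ?_) ?_
    · rw [coeff_derivX]
      rcases hj.eq_or_lt with rfl | hj
      · rw [hM.coeff_natDegree, Polynomial.derivative_one]
      · rw [Polynomial.coeff_eq_zero_of_natDegree_lt hj, map_zero]
    · have := derivative_algHom_apply φ hφ M
      rw [(hker M).2 dvd_rfl, h, map_zero, add_zero] at this
      exact (mul_eq_zero.1 this.symm).resolve_right hx
  obtain ⟨H, hH⟩ := exists_pow_eq_of_derivatives_eq_zero p hX hY
  have h0 : φ H = 0 := by
    have := (hker M).2 dvd_rfl
    rw [hH, map_pow] at this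
    exact pow_eq_zero_iff (Fact.out : p.Prime).ne_zero |>.1 this
  have hH0 : H ≠ 0 := by
    rintro rfl
    rw [zero_pow (Fact.out : p.Prime).ne_zero] at hH
    exact hM.ne_zero hH
  have h3 := Polynomial.natDegree_le_of_dvd ((hker H).1 h0) hH0
  have h4 : M.natDegree = p * H.natDegree := by rw [hH, Polynomial.natDegree_pow]
  have h5 := (Fact.out : p.Prime).two_le
  nlinarith

end Separability

section Deformation

variable {k : Type*} [Field k] {O : Type*} [CommRing O] [Algebra k O]

/-- Power series over `O` whose `i`-th coefficient is the value of a polynomial of total degree at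
most `c + i * e`. -/
def weighted (φ : Polynomial (Polynomial k) →ₐ[k] O) (e c : ℕ) : Submodule k (PowerSeries O) where
  carrier := {a | ∀ i, PowerSeries.coeff i a ∈ lowDegValues φ (c + i * e)}
  add_mem' ha hb i := by
    rw [map_add]
    exact Submodule.add_mem _ (ha i) (hb i)
  zero_mem' i := by
    rw [map_zero]
    exact Submodule.zero_mem _
  smul_mem' r a ha i := by
    rw [PowerSeries.coeff_smul]
    exact Submodule.smul_mem _ _ (ha i)

variable {φ : Polynomial (Polynomial k) →ₐ[k] O} {e : ℕ}

theorem weighted_mono {c c' : ℕ} (h : c ≤ c') : weighted φ e c ≤ weighted φ e c' :=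
  fun _ ha i => lowDegValues_mono (by omega) (ha i)

theorem mul_mem_weighted {c c' : ℕ} {a b : PowerSeries O} (ha : a ∈ weighted φ e c)
    (hb : b ∈ weighted φ e c') : a * b ∈ weighted φ e (c + c') := by
  intro i
  rw [PowerSeries.coeff_mul]
  refine Submodule.sum_mem _ fun p hp => ?_
  rw [Finset.HasAntidiagonal.mem_antidiagonal] at hp
  refine lowDegValues_mono (le_of_eq ?_) (mul_mem_lowDegValues (ha p.1) (hb p.2))
  rw [← hp]; ring

theorem C_mem_weighted {c : ℕ} {a : O} (ha : a ∈ lowDegValues φ c) :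
    PowerSeries.C a ∈ weighted φ e c := by
  intro i
  rw [PowerSeries.coeff_C]
  split_ifs with h
  · exact lowDegValues_mono (by omega) ha
  · exact Submodule.zero_mem _

theorem one_mem_weighted (c : ℕ) : (1 : PowerSeries O) ∈ weighted φ e c := by
  simpa using C_mem_weighted (e := e) (one_mem_lowDegValues (φ := φ) c)

theorem pow_mem_weighted {c : ℕ} {a : PowerSeries O} (ha : a ∈ weighted φ e c) (n : ℕ) :
    a ^ n ∈ weighted φ e (c * n) := by
  induction n with
  | zero => simpa using one_mem_weighted 0
  | succ n ih => rw [pow_succ, Nat.mul_succ]; exact mul_mem_weighted ih ha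

theorem X_mul_mem_weighted {c : ℕ} {a : PowerSeries O} (ha : a ∈ weighted φ e (c + e)) :
    PowerSeries.X * a ∈ weighted φ e c := by
  intro i
  cases i with
  | zero => rw [PowerSeries.coeff_zero_X_mul]; exact Submodule.zero_mem _
  | succ i =>
    rw [PowerSeries.coeff_succ_X_mul]
    refine lowDegValues_mono (le_of_eq ?_) (ha i)
    ring

theorem natCast_mul_mem_weighted {c : ℕ} {a : PowerSeries O} (ha : a ∈ weighted φ e c) (n : ℕ) :
    (n : PowerSeries O) * a ∈ weighted φ e c := by
  rw [← nsmul_eq_mul]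
  exact Submodule.smul_of_tower_mem _ n ha

/-- The evaluation homomorphism at a deformation of the point underlying `φ`. -/
def deform (φ : Polynomial (Polynomial k) →ₐ[k] O) (U T : PowerSeries O) :
    Polynomial (Polynomial k) →ₐ[k] PowerSeries O :=
  Polynomial.aevalAeval (PowerSeries.C (φ (Polynomial.C Polynomial.X)) + U)
    (PowerSeries.C (φ Polynomial.X) + T)

theorem deform_C_X (U T : PowerSeries O) : deform φ U T (Polynomial.C Polynomial.X) =
    PowerSeries.C (φ (Polynomial.C Polynomial.X)) + U :=
  Polynomial.aevalAeval_X _ _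

theorem deform_X (U T : PowerSeries O) : deform φ U T Polynomial.X =
    PowerSeries.C (φ Polynomial.X) + T :=
  Polynomial.aevalAeval_Y _ _

theorem X_value_mem : φ (Polynomial.C Polynomial.X) ∈ lowDegValues φ 1 :=
  map_mem_lowDegValues φ C_X_mem_lowDeg

theorem Y_value_mem : φ Polynomial.X ∈ lowDegValues φ 1 :=
  map_mem_lowDegValues φ X_mem_lowDeg

theorem deform_mem_weighted {U T : PowerSeries O} (hU : U ∈ weighted φ e 1)
    (hT : T ∈ weighted φ e 1) {n : ℕ} {P : Polynomial (Polynomial k)} (hP : P ∈ lowDeg k n) :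
    deform φ U T P ∈ weighted φ e n := by
  refine map_mem_of_mem_lowDeg (deform φ U T).toLinearMap _ (fun i j hij => ?_) hP
  rw [AlgHom.toLinearMap_apply, map_mul, map_pow, map_pow, map_pow, deform_C_X, deform_X]
  refine weighted_mono (c := 1 * i + 1 * j) (by omega) (mul_mem_weighted (pow_mem_weighted ?_ _)
    (pow_mem_weighted ?_ _))
  · exact Submodule.add_mem _ (C_mem_weighted X_value_mem) hU
  · exact Submodule.add_mem _ (C_mem_weighted Y_value_mem) hT

/-- Functions of several power series that respect congruences modulo powers of the variable and
send series of weights `d` to series of weight `c`. -/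
structure TameFun (φ : Polynomial (Polynomial k) →ₐ[k] O) (e : ℕ) {ι : Type} (d : ι → ℕ) (c : ℕ)
    (α : (ι → PowerSeries O) → PowerSeries O) : Prop where
  mem : ∀ {v}, (∀ i, v i ∈ weighted φ e (d i)) → α v ∈ weighted φ e c
  cong : ∀ {N : ℕ} {v v'}, (∀ i, PowerSeries.X ^ N ∣ v i - v' i) → PowerSeries.X ^ N ∣ α v - α v'

namespace TameFun

variable {ι κ : Type} {d : ι → ℕ} {d' : κ → ℕ} {c c' : ℕ}
  {α β : (ι → PowerSeries O) → PowerSeries O}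

theorem const {a : PowerSeries O} (ha : a ∈ weighted φ e c) : TameFun φ e d c fun _ => a :=
  ⟨fun _ => ha, fun _ => by simp⟩

theorem proj (i : ι) : TameFun φ e d (d i) fun v => v i := ⟨fun h => h i, fun h => h i⟩

theorem add (hα : TameFun φ e d c α) (hβ : TameFun φ e d c β) :
    TameFun φ e d c fun v => α v + β v :=
  ⟨fun hv => Submodule.add_mem _ (hα.mem hv) (hβ.mem hv), fun hv => by
    have := dvd_add (hα.cong hv) (hβ.cong hv)
    rwa [sub_add_sub_comm] at this⟩

theorem mul (hα : TameFun φ e d c α) (hβ : TameFun φ e d c' β) :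
    TameFun φ e d (c + c') fun v => α v * β v :=
  ⟨fun hv => mul_mem_weighted (hα.mem hv) (hβ.mem hv), fun {N v v'} hv => by
    have := dvd_add ((hα.cong hv).mul_right (β v)) ((hβ.cong hv).mul_left (α v'))
    have h : α v * β v - α v' * β v' = (α v - α v') * β v + α v' * (β v - β v') := by ring
    rwa [h]⟩

theorem mono (h : c ≤ c') (hα : TameFun φ e d c α) : TameFun φ e d c' α :=
  ⟨fun hv => weighted_mono h (hα.mem hv), hα.cong⟩

theorem pow (hα : TameFun φ e d c α) (n : ℕ) : TameFun φ e d (c * n) fun v => α v ^ n := by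
  induction n with
  | zero => simpa using const (one_mem_weighted 0)
  | succ n ih => simp only [pow_succ, Nat.mul_succ]; exact ih.mul hα

theorem smul (r : k) (hα : TameFun φ e d c α) : TameFun φ e d c fun v => r • α v :=
  ⟨fun hv => Submodule.smul_mem _ _ (hα.mem hv), fun hv => by
    rw [← smul_sub, Algebra.smul_def]; exact (hα.cong hv).mul_left _⟩

theorem neg (hα : TameFun φ e d c α) : TameFun φ e d c fun v => -α v := by
  simpa using hα.smul (-1)

theorem X_mul (hα : TameFun φ e d (c + e) α) : TameFun φ e d c fun v => PowerSeries.X * α v :=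
  ⟨fun hv => X_mul_mem_weighted (hα.mem hv), fun hv => by
    rw [← mul_sub]; exact (hα.cong hv).mul_left _⟩

theorem comp (hα : TameFun φ e d c α) {g : ι → (κ → PowerSeries O) → PowerSeries O}
    (hg : ∀ i, TameFun φ e d' (d i) (g i)) : TameFun φ e d' c fun v => α fun i => g i v :=
  ⟨fun hv => hα.mem fun i => (hg i).mem hv, fun hv => hα.cong fun i => (hg i).cong hv⟩

end TameFun

/-- The second-order Taylor remainder coefficient of `(x + U) ^ i`. -/
def powRemainder (x U : PowerSeries O) : ℕ → PowerSeries O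
  | 0 => 0
  | i + 1 => (x + U) * powRemainder x U i + i * x ^ (i - 1)

theorem add_pow_eq_powRemainder (x U : PowerSeries O) (i : ℕ) :
    (x + U) ^ i = x ^ i + i * x ^ (i - 1) * U + U ^ 2 * powRemainder x U i := by
  induction i with
  | zero => simp [powRemainder]
  | succ i ih =>
    rw [pow_succ, ih, powRemainder]
    cases i with
    | zero => simp [powRemainder]
    | succ i => simp only [Nat.add_sub_cancel]; push_cast; ring

theorem tameFun_powRemainder {x : PowerSeries O} (hx : x ∈ weighted φ e 1)
    {ι : Type} {d : ι → ℕ} {p : (ι → PowerSeries O) → PowerSeries O} (hp : TameFun φ e d 1 p)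
    (i : ℕ) : TameFun φ e d i fun v => powRemainder x (p v) (i + 2) := by
  induction i with
  | zero =>
    simp only [powRemainder]
    simpa using TameFun.const (one_mem_weighted 0)
  | succ i ih =>
    simp only [powRemainder] at ih ⊢
    refine TameFun.add ?_ (TameFun.const ?_)
    · refine TameFun.mono (by omega) (((TameFun.const hx).add hp).mul ih)
    · refine natCast_mul_mem_weighted (weighted_mono (by omega) (pow_mem_weighted hx _)) _

/-- Polynomials whose deformations have a second-order Taylor expansion with remainder
coefficients of weight `n`. -/
def taylorSubmodule (φ : Polynomial (Polynomial k) →ₐ[k] O) (e n : ℕ) :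
    Submodule k (Polynomial (Polynomial k)) where
  carrier := {P | ∃ α β γ, TameFun φ e ![1, 1] n α ∧ TameFun φ e ![1, 1] n β ∧
    TameFun φ e ![1, 1] n γ ∧ ∀ U T, deform φ U T P = PowerSeries.C (φ P) + PowerSeries.C (φ (derivX k P)) * U +
      PowerSeries.C (φ (Polynomial.derivative P)) * T +
      (α ![U, T] * U ^ 2 + β ![U, T] * (U * T) + γ ![U, T] * T ^ 2)}
  add_mem' := by
    rintro P Q ⟨α, β, γ, hα, hβ, hγ, h⟩ ⟨α', β', γ', hα', hβ', hγ', h'⟩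
    refine ⟨_, _, _, hα.add hα', hβ.add hβ', hγ.add hγ', fun U T => ?_⟩
    simp only [map_add, h, h']
    ring
  zero_mem' := ⟨_, _, _, TameFun.const (Submodule.zero_mem _), TameFun.const (Submodule.zero_mem _),
    TameFun.const (Submodule.zero_mem _), fun U T => by simp⟩
  smul_mem' := by
    rintro r P ⟨α, β, γ, hα, hβ, hγ, h⟩
    refine ⟨_, _, _, hα.smul r, hβ.smul r, hγ.smul r, fun U T => ?_⟩
    have hC : ∀ a : O, PowerSeries.C (r • a) = r • (PowerSeries.C a : PowerSeries O) := by
      intro a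
      ext i
      simp only [PowerSeries.coeff_smul, PowerSeries.coeff_C]
      split_ifs <;> simp
    simp only [map_smul, h, hC, Polynomial.derivative_smul, smul_add, smul_mul_assoc]

theorem lowDeg_le_taylorSubmodule {n : ℕ} {P : Polynomial (Polynomial k)}
    (hP : P ∈ lowDeg k (n + 2)) : P ∈ taylorSubmodule φ e n := by
  refine map_mem_of_mem_lowDeg LinearMap.id _ (fun i j hij => ?_) hP
  set x : PowerSeries O := PowerSeries.C (φ (Polynomial.C Polynomial.X)) with hx
  set y : PowerSeries O := PowerSeries.C (φ Polynomial.X) with hy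
  have hxm : x ∈ weighted φ e 1 := C_mem_weighted X_value_mem
  have hym : y ∈ weighted φ e 1 := C_mem_weighted Y_value_mem
  have hα : TameFun φ e ![1, 1] n fun v => powRemainder x (v 0) i * (y + v 1) ^ j := by
    match i, hij with
    | 0, _ => simpa [powRemainder] using TameFun.const (Submodule.zero_mem _)
    | 1, _ => simpa [powRemainder] using TameFun.const (Submodule.zero_mem _)
    | i + 2, hij =>
      exact ((tameFun_powRemainder hxm (TameFun.proj 0) i).mul
        (((TameFun.const hym).add (TameFun.proj 1)).pow j)).mono (by omega)
  have hβ : TameFun φ e ![1, 1] n fun _ => i * j * (x ^ (i - 1) * y ^ (j - 1)) := by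
    refine TameFun.const ?_
    rcases i with - | i
    · simp
    rcases j with - | j
    · simp
    rw [mul_assoc]
    exact natCast_mul_mem_weighted (natCast_mul_mem_weighted (weighted_mono (by
      simp only [Nat.add_sub_cancel]; omega)
      (mul_mem_weighted (pow_mem_weighted hxm _) (pow_mem_weighted hym _))) _) _
  have hγ : TameFun φ e ![1, 1] n fun v =>
      powRemainder y (v 1) j * (x ^ i + i * x ^ (i - 1) * v 0) := by
    match j, hij with
    | 0, _ => simpa [powRemainder] using TameFun.const (Submodule.zero_mem _)
    | 1, _ => simpa [powRemainder] using TameFun.const (Submodule.zero_mem _)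
    | j + 2, hij =>
      refine ((tameFun_powRemainder hym (TameFun.proj 1) j).mul (c' := i)
        (TameFun.add (TameFun.const (weighted_mono (by omega) (pow_mem_weighted hxm i))) ?_)).mono
        (by omega)
      rcases i with - | i
      · simpa using TameFun.const (Submodule.zero_mem _)
      · exact ((TameFun.const (natCast_mul_mem_weighted (pow_mem_weighted hxm _) _)).mul
          (TameFun.proj 0)).mono (by simp)
  refine ⟨_, _, _, hα, hβ, hγ, fun U T => ?_⟩
  simp only [Matrix.cons_val_zero, Matrix.cons_val_one]
  have h1 : (Polynomial.C (Polynomial.X ^ i) * Polynomial.X ^ j : Polynomial (Polynomial k)) =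
      Polynomial.monomial j (Polynomial.monomial i 1) := by
    rw [Polynomial.C_mul_X_pow_eq_monomial, Polynomial.X_pow_eq_monomial]
  rw [LinearMap.id_apply, h1, derivX_monomial, Polynomial.derivative_monomial,
    Polynomial.derivative_monomial, ← nsmul_eq_mul', ← nsmul_eq_mul']
  simp only [map_nsmul, algHom_monomial_monomial, deform_C_X, deform_X, one_smul]
  rw [← hx, ← hy, add_pow_eq_powRemainder x U i, add_pow_eq_powRemainder y T j]
  simp only [map_mul, map_pow, ← hx, ← hy, nsmul_eq_mul]
  rw [show (y ^ j + j * y ^ (j - 1) * T + T ^ 2 * powRemainder y T j) = (y + T) ^ j from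
    (add_pow_eq_powRemainder y T j).symm]
  rw [mul_comm (powRemainder x U i), add_mul _ _ ((y + T) ^ j), add_pow_eq_powRemainder y T j]
  ring

theorem exists_deformation {M : Polynomial (Polynomial k)} (hM : M ∈ lowDeg k (e + 2))
    (hφM : φ M = 0) (m : ℕ) : ∃ U T : PowerSeries O, U ∈ weighted φ e 1 ∧ T ∈ weighted φ e 1 ∧
      PowerSeries.X ∣ U ∧ PowerSeries.X ∣ T ∧
      PowerSeries.coeff 1 U = φ (Polynomial.derivative M) ∧
      PowerSeries.X ^ m ∣ deform φ U T M := by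
  obtain ⟨α, β, γ, hα, hβ, hγ, htaylor⟩ := lowDeg_le_taylorSubmodule (φ := φ) (e := e) hM
  set Fx : PowerSeries O := PowerSeries.C (φ (derivX k M)) with hFx
  set Fy : PowerSeries O := PowerSeries.C (φ (Polynomial.derivative M)) with hFy
  have hFxm : Fx ∈ weighted φ e (1 + e) :=
    C_mem_weighted (lowDegValues_mono (by omega) (map_mem_lowDegValues φ (derivX_mem_lowDeg hM)))
  have hFym : Fy ∈ weighted φ e (1 + e) :=
    C_mem_weighted (lowDegValues_mono (by omega)
      (map_mem_lowDegValues φ (derivative_mem_lowDeg hM)))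
  let δ : Fin 2 → (Fin 3 → PowerSeries O) → PowerSeries O :=
    ![fun v => PowerSeries.X * (v 0 * Fx + (1 + v 1) * Fy),
      fun v => PowerSeries.X * (-Fx + v 2 * Fy)]
  have proj0 : ∀ i : Fin 3, TameFun φ e (fun _ : Fin 3 => 0) 0 fun v => v i := TameFun.proj
  have one0 : TameFun φ e (fun _ : Fin 3 => 0) 0 fun _ => (1 : PowerSeries O) :=
    TameFun.const (one_mem_weighted 0)
  have hδ : ∀ i, TameFun φ e (fun _ : Fin 3 => 0) ((![1, 1] : Fin 2 → ℕ) i) (δ i) := by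
    intro i
    fin_cases i
    · exact TameFun.X_mul ((((proj0 0).mul (TameFun.const hFxm)).add
        ((one0.add (proj0 1)).mul (TameFun.const hFym))).mono (by simp))
    · exact TameFun.X_mul (((TameFun.const hFxm).neg.add
        (((proj0 2).mul (TameFun.const hFym)).mono (zero_add _).le)).mono (by simp))
  let δ' : (Fin 3 → PowerSeries O) → Fin 2 → PowerSeries O := fun v i => δ i v
  have hα' := hα.comp hδ
  have hβ' := hβ.comp hδ
  have hγ' := hγ.comp hδ
  let N' : Fin 3 → (Fin 3 → PowerSeries O) → PowerSeries O :=
    ![fun v => -(α (δ' v) * v 0 ^ 2 + -(β (δ' v) * v 0) + γ (δ' v)),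
      fun v => -(α (δ' v) * ((1 + 1) * v 0 * (1 + v 1)) +
        β (δ' v) * (v 0 * v 2 + -(1 + v 1)) + -(γ (δ' v) * ((1 + 1) * v 2))),
      fun v => -(α (δ' v) * (1 + v 1) ^ 2 + β (δ' v) * ((1 + v 1) * v 2) + γ (δ' v) * v 2 ^ 2)]
  have hN' : ∀ i, TameFun φ e (fun _ : Fin 3 => 0) (0 + e) (N' i) := by
    intro i
    fin_cases i
    · exact TameFun.mono (zero_add e).ge (TameFun.neg
        (((hα'.mul ((proj0 0).pow 2)).add (hβ'.mul (proj0 0)).neg).add hγ'))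
    · exact TameFun.mono (zero_add e).ge (TameFun.neg
        (((hα'.mul (((one0.add one0).mul (proj0 0)).mul (one0.add (proj0 1)))).add
          (hβ'.mul (((proj0 0).mul (proj0 2)).add (one0.add (proj0 1)).neg))).add
          (hγ'.mul ((one0.add one0).mul (proj0 2))).neg))
    · exact TameFun.mono (zero_add e).ge (TameFun.neg
        (((hα'.mul ((one0.add (proj0 1)).pow 2)).add
          (hβ'.mul ((one0.add (proj0 1)).mul (proj0 2)))).add (hγ'.mul ((proj0 2).pow 2))))
  let N : Fin 3 → (Fin 3 → PowerSeries O) → PowerSeries O := fun i v => PowerSeries.X * N' i v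
  have hN : ∀ i, TameFun φ e (fun _ : Fin 3 => 0) 0 (N i) := fun i => TameFun.X_mul (hN' i)
  let step : (Fin 3 → PowerSeries O) → Fin 3 → PowerSeries O := fun v i => N i v
  let w : ℕ → Fin 3 → PowerSeries O := fun n => step^[n] 0
  have hw : ∀ n, w (n + 1) = step (w n) := fun n => Function.iterate_succ_apply' step n 0
  have hwm : ∀ n i, w n i ∈ weighted φ e 0 := by
    intro n
    induction n with
    | zero => intro i; exact Submodule.zero_mem _
    | succ n ih => intro i; rw [hw]; exact (hN i).mem ih
  have hX : ∀ v i, PowerSeries.X ∣ N i v :=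
    fun v i => dvd_mul_right _ _
  have hw0 : ∀ n i, PowerSeries.X ∣ w n i := by
    intro n i
    cases n with
    | zero => exact dvd_zero _
    | succ n => rw [hw]; exact hX _ i
  have hwc : ∀ n i, PowerSeries.X ^ n ∣ w n i - w (n + 1) i := by
    intro n
    induction n with
    | zero => simp
    | succ n ih =>
      intro i
      rw [hw (n + 1)]
      nth_rewrite 1 [hw n]
      simp only [step, N]
      rw [← mul_sub, pow_succ']
      exact mul_dvd_mul_left _ ((hN' i).cong ih)
  have hδm : ∀ i, δ i (w m) ∈ weighted φ e 1 := by
    intro i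
    have := (hδ i).mem (hwm m)
    fin_cases i <;> exact this
  refine ⟨δ 0 (w m), δ 1 (w m), hδm 0, hδm 1, dvd_mul_right _ _, dvd_mul_right _ _, ?_, ?_⟩
  · have h1 : δ 0 (w m) = PowerSeries.X * (w m 0 * Fx + (1 + w m 1) * Fy) := rfl
    have h2 : ∀ i, PowerSeries.constantCoeff (w m i) = 0 :=
      fun i => PowerSeries.X_dvd_iff.1 (hw0 m i)
    rw [h1, show (1 : ℕ) = 0 + 1 from rfl, PowerSeries.coeff_succ_X_mul,
      PowerSeries.coeff_zero_eq_constantCoeff_apply]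
    simp [h2, hFy]
  · have h1 : ∀ i, PowerSeries.X ^ m ∣ w m i - N i (w m) := by
      intro i
      have := hwc m i
      rwa [hw m] at this
    have h2 : deform φ (δ 0 (w m)) (δ 1 (w m)) M = PowerSeries.X *
        ((w m 0 - N 0 (w m)) * Fx ^ 2 + (w m 1 - N 1 (w m)) * (Fx * Fy) +
          (w m 2 - N 2 (w m)) * Fy ^ 2) := by
      have h3 : ![δ 0 (w m), δ 1 (w m)] = δ' (w m) := by
        funext i; fin_cases i <;> rfl
      rw [htaylor, hφM, map_zero, zero_add, h3]
      simp only [N, N', δ, Matrix.cons_val_zero, Matrix.cons_val_one, Matrix.cons_val]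
      ring
    rw [h2]
    exact Dvd.dvd.mul_left (dvd_add (dvd_add ((h1 0).mul_right _) ((h1 1).mul_right _))
      ((h1 2).mul_right _)) _

end Deformation

section Interpolation

variable {R : Type*} [CommRing R]

theorem coeff_divX_iterate (M : Polynomial R) (n i : ℕ) :
    (Polynomial.divX^[n] M).coeff i = M.coeff (i + n) := by
  induction n generalizing i with
  | zero => simp
  | succ n ih => rw [Function.iterate_succ_apply', Polynomial.coeff_divX, ih]; congr 1; ring

theorem sum_divX_iterate_mul_pow_mul_sub {S : Type*} [CommRing S] (g : R →+* S) (M : Polynomial R)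
    {D : ℕ} (hD : M.natDegree ≤ D) (y z : S) :
    (∑ b ∈ Finset.range D, (Polynomial.divX^[b + 1] M).eval₂ g y * z ^ b) * (z - y) =
      M.eval₂ g z - M.eval₂ g y := by
  have h1 : ∀ b, (Polynomial.divX^[b] M).eval₂ g y =
      (Polynomial.divX^[b + 1] M).eval₂ g y * y + g (M.coeff b) := by
    intro b
    conv_lhs => rw [← Polynomial.divX_mul_X_add (Polynomial.divX^[b] M)]
    rw [Polynomial.eval₂_add, Polynomial.eval₂_mul, Polynomial.eval₂_X, Polynomial.eval₂_C,
      coeff_divX_iterate, zero_add, Function.iterate_succ_apply']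
  have h2 : ∀ n, (∑ b ∈ Finset.range n, (Polynomial.divX^[b + 1] M).eval₂ g y * z ^ b) * (z - y) =
      (Polynomial.divX^[n] M).eval₂ g y * z ^ n - M.eval₂ g y +
        ∑ b ∈ Finset.range n, g (M.coeff b) * z ^ b := by
    intro n
    induction n with
    | zero => simp
    | succ n ih =>
      rw [Finset.sum_range_succ, add_mul, ih, Finset.sum_range_succ, h1 n]
      ring
  have h3 : Polynomial.divX^[D] M = Polynomial.C (M.coeff D) := by
    ext i
    rw [coeff_divX_iterate, Polynomial.coeff_C]
    split_ifs with hi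
    · rw [hi, zero_add]
    · exact Polynomial.coeff_eq_zero_of_natDegree_lt (by omega)
  rw [h2, h3, Polynomial.eval₂_C, Polynomial.eval₂_eq_sum_range' g (Nat.lt_succ_of_le hD) z,
    Finset.sum_range_succ]
  ring

theorem sum_divX_iterate_mul_X_pow (M : Polynomial R) {D : ℕ} (hD : M.natDegree ≤ D) :
    ∑ b ∈ Finset.range D, Polynomial.divX^[b + 1] M * Polynomial.X ^ b =
      Polynomial.derivative M := by
  ext i
  rw [Polynomial.finsetSum_coeff, Polynomial.coeff_derivative]
  have h1 : ∀ b, (Polynomial.divX^[b + 1] M * Polynomial.X ^ b).coeff i =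
      if b ≤ i then M.coeff (i + 1) else 0 := by
    intro b
    rw [Polynomial.coeff_mul_X_pow']
    split_ifs with h
    · rw [coeff_divX_iterate]; congr 1; omega
    · rfl
  simp only [h1]
  by_cases hi : i + 1 ≤ D
  · rw [← Finset.sum_filter, Finset.sum_const, nsmul_eq_mul, mul_comm]
    congr 1
    have : (Finset.range D).filter (· ≤ i) = Finset.range (i + 1) := by ext; simp; omega
    rw [this]
    simp
  · rw [Polynomial.coeff_eq_zero_of_natDegree_lt (by omega)]
    simp

variable {k : Type*} [Field k]

theorem divX_iterate_mem_lowDeg {M : Polynomial (Polynomial k)} {D : ℕ} (hM : M ∈ lowDeg k D)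
    (n : ℕ) : Polynomial.divX^[n] M ∈ lowDeg k (D - n) := by
  intro i j hij
  rw [coeff_divX_iterate]
  exact hM _ _ (by omega)

variable [Fintype k]

theorem prod_X_sub_C_univ : ∏ a : k, (Polynomial.X - Polynomial.C a) =
    Polynomial.X ^ Fintype.card k - Polynomial.X := by
  have h := FiniteField.roots_X_pow_card_sub_X k
  have hq : 1 < Fintype.card k := Fintype.one_lt_card
  have hm : (Polynomial.X ^ Fintype.card k - Polynomial.X : Polynomial k).Monic :=
    Polynomial.monic_X_pow_sub (by rw [Polynomial.degree_X]; exact_mod_cast hq)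
  rw [← Polynomial.prod_multiset_X_sub_C_of_monic_of_roots_card_eq hm]
  · rw [h]; rfl
  · rw [h, FiniteField.X_pow_card_sub_X_natDegree_eq k hq]; rfl

theorem dvd_of_forall_eval_eq_zero {p : Polynomial k} (h : ∀ a, p.eval a = 0) :
    Polynomial.X ^ Fintype.card k - Polynomial.X ∣ p := by
  rw [← prod_X_sub_C_univ]
  refine Finset.prod_dvd_of_coprime (fun a _ b _ hab => ?_) fun a _ =>
    Polynomial.dvd_iff_isRoot.2 (h a)
  exact Polynomial.isCoprime_X_sub_C_of_isUnit_sub (sub_ne_zero.2 hab).isUnit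

/-- If every vanishing fibre condition of `w` modulo `M` holds at the points of `k`, then `w` is
divisible by `X ^ q - X` modulo `M`, without loss of total degree. -/
theorem exists_dvd_sub_of_forall_map_dvd {M : Polynomial (Polynomial k)} {D : ℕ} (hM : M.Monic)
    (hMD : M.natDegree = D) (hMl : M ∈ lowDeg k D) {n : ℕ} {w : Polynomial (Polynomial k)}
    (hw : w ∈ lowDeg k n)
    (h : ∀ a : k, M.map (Polynomial.evalRingHom a) ∣ w.map (Polynomial.evalRingHom a)) :
    ∃ g ∈ lowDeg k (n - Fintype.card k), (n < Fintype.card k → g = 0) ∧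
      M ∣ Polynomial.C (Polynomial.X ^ Fintype.card k - Polynomial.X) * g - w := by
  obtain ⟨R, hR, hRD, hdvd⟩ := exists_reduction hM hMD hMl n w hw
  have hR0 : ∀ a : k, R.map (Polynomial.evalRingHom a) = 0 := by
    intro a
    refine Polynomial.eq_zero_of_dvd_of_degree_lt (p := M.map (Polynomial.evalRingHom a)) ?_ ?_
    · have := Polynomial.map_dvd (Polynomial.evalRingHom a) hdvd
      rw [Polynomial.map_sub] at this
      exact (dvd_sub_right (h a)).1 this
    · rw [Polynomial.degree_eq_natDegree (hM.map _).ne_zero, hM.natDegree_map, hMD]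
      exact (Polynomial.degree_map_le).trans_lt hRD
  have hC : Polynomial.C (Polynomial.X ^ Fintype.card k - Polynomial.X) ∣ R := by
    rw [Polynomial.C_dvd_iff_dvd_coeff]
    intro j
    refine dvd_of_forall_eval_eq_zero fun a => ?_
    have := congrArg (Polynomial.coeff · j) (hR0 a)
    simpa [Polynomial.coeff_map] using this
  obtain ⟨g, rfl⟩ := hC
  have hq : 1 < Fintype.card k := Fintype.one_lt_card
  have hdeg : ∀ j, g.coeff j ≠ 0 → Fintype.card k + (g.coeff j).natDegree + j ≤ n := by
    intro j hj
    have h0 := FiniteField.X_pow_card_sub_X_ne_zero k hq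
    have h1 := mem_lowDeg_iff_degree.1 hR j
    rw [Polynomial.coeff_C_mul, Polynomial.degree_eq_natDegree (mul_ne_zero h0 hj),
      Polynomial.natDegree_mul h0 hj, FiniteField.X_pow_card_sub_X_natDegree_eq k hq] at h1
    have h2 := Nat.cast_lt.1 h1
    omega
  refine ⟨g, ?_, fun hn => ?_, ?_⟩
  · rw [mem_lowDeg_iff_degree]
    intro j
    by_cases hj : g.coeff j = 0
    · rw [hj, Polynomial.degree_zero]; exact WithBot.bot_lt_coe _
    · rw [Polynomial.degree_eq_natDegree hj]
      have := hdeg j hj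
      exact_mod_cast (by omega : (g.coeff j).natDegree < n - Fintype.card k + 1 - j)
  · ext1 j
    by_contra hj
    have := hdeg j hj
    omega
  · rw [← neg_sub]; exact (dvd_neg).2 hdvd

theorem map_dvd_mul_sum_divX {p l : Polynomial k} {D : ℕ} (hD : p.natDegree ≤ D)
    (h : ∀ c, p.eval c = 0 → l.eval c = 0) :
    p ∣ l * ∑ b ∈ Finset.range D, Polynomial.divX^[b + 1] p *
      Polynomial.X ^ (Fintype.card k * b) := by
  classical
  set F₁ := ∑ b ∈ Finset.range D, Polynomial.divX^[b + 1] p * Polynomial.X ^ (Fintype.card k * b)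
    with hF₁
  have h1 : p ∣ F₁ * (Polynomial.X ^ Fintype.card k - Polynomial.X) := by
    have h2 := sum_divX_iterate_mul_pow_mul_sub Polynomial.C p hD Polynomial.X
      (Polynomial.X ^ Fintype.card k)
    simp only [Polynomial.eval₂_C_X, ← pow_mul] at h2
    rw [hF₁, h2]
    have h3 : p.eval₂ Polynomial.C (Polynomial.X ^ Fintype.card k) = p ^ Fintype.card k := by
      exact FiniteField.expand_card p
    rw [h3]
    exact dvd_sub (dvd_pow_self _ Fintype.card_ne_zero) dvd_rfl
  rw [← prod_X_sub_C_univ, ← Finset.prod_filter_mul_prod_filter_not Finset.univ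
    (fun c => p.eval c = 0), ← mul_assoc] at h1
  have h2 : IsCoprime p (∏ c ∈ Finset.univ.filter (fun c : k => ¬p.eval c = 0),
      (Polynomial.X - Polynomial.C c)) := by
    refine IsCoprime.prod_right fun c hc => ?_
    rw [Finset.mem_filter] at hc
    rw [isCoprime_comm, Polynomial.irreducible_X_sub_C c |>.coprime_iff_not_dvd,
      Polynomial.dvd_iff_isRoot]
    exact hc.2
  have h3 := h2.dvd_of_dvd_mul_right h1
  rw [mul_comm l]
  refine h3.trans (mul_dvd_mul_left _ ?_)
  refine Finset.prod_dvd_of_coprime (fun a _ b _ hab => ?_) fun c hc =>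
    Polynomial.dvd_iff_isRoot.2 (h c (Finset.mem_filter.1 hc).2)
  exact Polynomial.isCoprime_X_sub_C_of_isUnit_sub (sub_ne_zero.2 hab).isUnit

theorem map_divX_iterate {S : Type*} [CommRing S] (g : R →+* S) (M : Polynomial R) (n : ℕ) :
    (Polynomial.divX^[n] M).map g = Polynomial.divX^[n] (M.map g) := by
  ext i
  simp [coeff_divX_iterate, Polynomial.coeff_map]

theorem exists_auxiliary {M l : Polynomial (Polynomial k)} {e : ℕ} (hM : M.Monic)
    (hMD : M.natDegree = e + 2) (hMl : M ∈ lowDeg k (e + 2)) (hl : l ∈ lowDeg k 2)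
    (hz : ∀ a c : k, (M.map (Polynomial.evalRingHom a)).eval c = 0 →
      (l.map (Polynomial.evalRingHom a)).eval c = 0) :
    ∃ g ∈ lowDeg k (Fintype.card k * e + 2),
      M ∣ Polynomial.C (Polynomial.X ^ Fintype.card k - Polynomial.X) * g -
        l * ∑ b ∈ Finset.range (e + 2), Polynomial.divX^[b + 1] M *
          Polynomial.X ^ (Fintype.card k * b) := by
  have hw : l * ∑ b ∈ Finset.range (e + 2), Polynomial.divX^[b + 1] M *
      Polynomial.X ^ (Fintype.card k * b) ∈ lowDeg k (2 + Fintype.card k * (e + 1)) := by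
    refine mul_mem_lowDeg hl (Submodule.sum_mem _ fun b hb => ?_)
    rw [Finset.mem_range] at hb
    refine lowDeg_mono ?_ (mul_mem_lowDeg (divX_iterate_mem_lowDeg hMl _) (X_pow_mem_lowDeg _))
    have hq : 1 ≤ Fintype.card k := Fintype.card_pos
    obtain ⟨s, hs⟩ : ∃ s, e + 1 = b + s := ⟨e + 1 - b, by omega⟩
    rw [hs, mul_add, show e + 2 - (b + 1) = s by omega]
    nlinarith
  obtain ⟨g, hg, -, hdvd⟩ := exists_dvd_sub_of_forall_map_dvd hM hMD hMl hw fun a => by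
    rw [Polynomial.map_mul, Polynomial.map_sum]
    simp only [Polynomial.map_mul, Polynomial.map_pow, Polynomial.map_X, map_divX_iterate]
    exact map_dvd_mul_sum_divX (by rw [hM.natDegree_map, hMD]) (hz a)
  refine ⟨g, lowDeg_mono (le_of_eq ?_) hg, hdvd⟩
  rw [mul_add, mul_one]
  omega

theorem dvd_of_natDegree_eq_one {M l : Polynomial (Polynomial k)} (hq : 2 < Fintype.card k)
    (hM : M.Monic) (hMD : M.natDegree = 1) (hMl : M ∈ lowDeg k 1) (hl : l ∈ lowDeg k 2)
    (hz : ∀ a c : k, (M.map (Polynomial.evalRingHom a)).eval c = 0 →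
      (l.map (Polynomial.evalRingHom a)).eval c = 0) : M ∣ l := by
  obtain ⟨g, -, hg, hdvd⟩ := exists_dvd_sub_of_forall_map_dvd hM hMD hMl hl fun a => by
    have h1 := Polynomial.eq_X_add_C_of_natDegree_le_one (p := M.map (Polynomial.evalRingHom a))
      (by rw [hM.natDegree_map, hMD])
    have h2 : (M.map (Polynomial.evalRingHom a)).coeff 1 = 1 := by
      rw [← hMD, ← hM.natDegree_map (Polynomial.evalRingHom a)]
      exact (hM.map _).coeff_natDegree
    rw [h2, map_one, one_mul] at h1
    set c := (M.map (Polynomial.evalRingHom a)).coeff 0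
    rw [h1, ← sub_neg_eq_add, ← map_neg, Polynomial.dvd_iff_isRoot]
    refine hz a (-c) ?_
    rw [h1]
    simp
  rw [hg hq, mul_zero, zero_sub] at hdvd
  exact (dvd_neg (a := M)).1 hdvd

end Interpolation

section TwistedRelation

variable {k : Type*} [Field k] {O : Type*} [CommRing O] [Algebra k O]
  {φ : Polynomial (Polynomial k) →ₐ[k] O} {e : ℕ}

theorem constantCoeff_deform {U T : PowerSeries O} (hU : PowerSeries.constantCoeff U = 0)
    (hT : PowerSeries.constantCoeff T = 0) (P : Polynomial (Polynomial k)) :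
    PowerSeries.constantCoeff (deform φ U T P) = φ P := by
  induction P using Polynomial.induction_on' with
  | add P Q hP hQ => simp only [map_add, hP, hQ]
  | monomial j p =>
    induction p using Polynomial.induction_on' with
    | add p q hp hq => simp only [map_add, hp, hq]
    | monomial i c =>
      rw [algHom_monomial_monomial, algHom_monomial_monomial, deform_C_X, deform_X]
      rw [← PowerSeries.coeff_zero_eq_constantCoeff_apply, PowerSeries.coeff_smul,
        PowerSeries.coeff_zero_eq_constantCoeff_apply]
      simp [hU, hT]

theorem mul_mem_coeffsIn {c c' n : ℕ} {P Q : MvPolynomial O O} (hn : c + c' ≤ n)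
    (hP : P ∈ coeffsIn O (lowDegValues φ c)) (hQ : Q ∈ coeffsIn O (lowDegValues φ c')) :
    P * Q ∈ coeffsIn O (lowDegValues φ n) := by
  have h1 := Submodule.mul_mem_mul hP hQ
  rw [← coeffsIn_mul] at h1
  intro s
  have h2 : lowDegValues φ c * lowDegValues φ c' ≤ lowDegValues φ n :=
    Submodule.mul_le.2 fun a ha b hb => lowDegValues_mono hn (mul_mem_lowDegValues ha hb)
  exact h2 (h1 s)

/-- Polynomials interpolating the coefficients of a solution of a twisted relation: their values at
`q`-th powers are multiples of those coefficients, their plain values are known, and their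
coefficients have bounded weight. -/
theorem exists_interpolating {x y : O} {U Ψ : PowerSeries O} {B : ℕ → PowerSeries O} {m r q : ℕ}
    (hx : x ∈ lowDegValues φ 1)
    (hU : U ∈ weighted φ e 1) (hB : ∀ b, B b ∈ weighted φ e (e + 3)) (hXU : PowerSeries.X ∣ U)
    (hdvd : PowerSeries.X ^ m ∣ (PowerSeries.C (x ^ q - x) - U) * Ψ -
      ∑ b ∈ Finset.range r, B b * PowerSeries.C (y ^ q) ^ b) (i : ℕ) :
    ∃ N : MvPolynomial O O, N ∈ coeffsIn O (lowDegValues φ (e + 3 + i * (e + 1))) ∧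
      (i < m → aeval (fun w : O => w ^ q) N = (x ^ q - x) ^ (i + 1) * PowerSeries.coeff i Ψ) ∧
      aeval (fun w : O => w) N = (∑ b ∈ Finset.range r, PowerSeries.coeff 0 (B b) * y ^ b) *
        PowerSeries.coeff 1 U ^ i := by
  set z : MvPolynomial O O := X x - C x with hz
  have hzm : z ∈ coeffsIn O (lowDegValues φ 1) := by
    refine Submodule.sub_mem _ ?_ (C_mem_coeffsIn.2 hx)
    exact monomial_mem_coeffsIn.2 (one_mem_lowDegValues 1)
  have hzpow : ∀ j, z ^ j ∈ coeffsIn O (lowDegValues φ j) := by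
    intro j
    induction j with
    | zero => rw [pow_zero]; exact one_coeffsIn.2 (one_mem_lowDegValues 0)
    | succ j ih => rw [pow_succ]; exact mul_mem_coeffsIn le_rfl ih hzm
  have hzq : aeval (fun w : O => w ^ q) z = x ^ q - x := by simp [hz]
  have hz1 : aeval (fun w : O => w) z = 0 := by simp [hz]
  let num : ℕ → MvPolynomial O O := fun i =>
    ∑ b ∈ Finset.range r, C (PowerSeries.coeff i (B b)) * X y ^ b
  have hnum : ∀ i, num i ∈ coeffsIn O (lowDegValues φ (e + 3 + i * e)) := by
    intro i
    refine Submodule.sum_mem _ fun b _ => ?_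
    rw [X_pow_eq_monomial]
    exact mul_monomial_mem_coeffsIn.2 (C_mem_coeffsIn.2 (hB b i))
  obtain ⟨U', rfl⟩ := hXU
  have hrel : ∀ i < m, (x ^ q - x) * PowerSeries.coeff i Ψ = aeval (fun w : O => w ^ q) (num i) +
      PowerSeries.coeff i (PowerSeries.X * (U' * Ψ)) := by
    intro i hi
    have h1 := PowerSeries.X_pow_dvd_iff.1 hdvd i hi
    have h2 : ∀ b, B b * PowerSeries.C (y ^ q) ^ b = PowerSeries.C (y ^ (q * b)) * B b := by
      intro b; rw [← map_pow, ← pow_mul, mul_comm]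
    rw [sub_mul, mul_assoc, map_sub, map_sub, PowerSeries.coeff_C_mul, map_sum] at h1
    simp only [h2, PowerSeries.coeff_C_mul] at h1
    simp only [num, map_sum, map_mul, map_pow, aeval_X, aeval_C, Algebra.algebraMap_self,
      RingHom.id_apply, ← pow_mul]
    rw [Finset.sum_congr rfl fun b _ => mul_comm (PowerSeries.coeff i (B b)) (y ^ (q * b))]
    linear_combination h1
  induction i using Nat.strong_induction_on with
  | _ i ih =>
  have hnum1 : aeval (fun w : O => w) (num 0) =
      ∑ b ∈ Finset.range r, PowerSeries.coeff 0 (B b) * y ^ b := by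
    simp [num]
  cases i with
  | zero =>
    refine ⟨num 0, by simpa using hnum 0, fun h0 => ?_, by rw [hnum1, pow_zero, mul_one]⟩
    have := hrel 0 h0
    rw [PowerSeries.coeff_zero_X_mul, add_zero] at this
    rw [zero_add, pow_one, this]
  | succ i =>
    choose! N hNm hNq hN1 using ih
    refine ⟨z ^ (i + 1) * num (i + 1) + ∑ j ∈ Finset.range (i + 1),
      C (PowerSeries.coeff j U') * (z ^ j * N (i - j)), ?_, fun hi => ?_, ?_⟩
    · refine Submodule.add_mem _ (mul_mem_coeffsIn ?_ (hzpow _) (hnum _)) (Submodule.sum_mem _ fun j hj =>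
        mul_mem_coeffsIn (c := 1 + (j + 1) * e) ?_ (C_mem_coeffsIn.2 ?_)
          (mul_mem_coeffsIn le_rfl (hzpow _) (hNm (i - j) (by omega))))
      · apply le_of_eq; ring
      · rw [Finset.mem_range] at hj
        obtain ⟨s, rfl⟩ : ∃ s, i = j + s := ⟨i - j, by omega⟩
        rw [Nat.add_sub_cancel_left]
        apply le_of_eq; ring
      · have := hU (j + 1)
        rwa [PowerSeries.coeff_succ_X_mul] at this
    · rw [map_add, map_mul, map_pow, hzq, pow_succ _ (i + 1), mul_assoc, hrel (i + 1) hi,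
        PowerSeries.coeff_succ_X_mul, PowerSeries.coeff_mul,
        Finset.Nat.sum_antidiagonal_eq_sum_range_succ
          (fun a b => PowerSeries.coeff a U' * PowerSeries.coeff b Ψ), mul_add]
      congr 1
      rw [map_sum, Finset.mul_sum]
      refine Finset.sum_congr rfl fun j hj => ?_
      rw [Finset.mem_range] at hj
      obtain ⟨s, rfl⟩ : ∃ s, i = j + s := ⟨i - j, by omega⟩
      rw [Nat.add_sub_cancel_left, map_mul, map_mul, map_pow, hzq, hNq s (by omega) (by omega),
        aeval_C, Algebra.algebraMap_self, RingHom.id_apply]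
      ring
    · rw [map_add, map_mul, map_pow, hz1, zero_pow (by omega), zero_mul, zero_add,
        Finset.sum_range_succ', map_add, map_sum, Finset.sum_eq_zero, zero_add]
      · rw [map_mul, map_mul, pow_zero, map_one, one_mul, Nat.sub_zero, hN1 i (by omega), aeval_C,
          show (1 : ℕ) = 0 + 1 from rfl, PowerSeries.coeff_succ_X_mul, Algebra.algebraMap_self,
          RingHom.id_apply]
        ring
      · intro j _
        rw [map_mul, map_mul, map_pow, hz1, zero_pow (by omega), zero_mul, mul_zero]

variable [Fintype k]

theorem X_pow_dvd_add_pow_card_sub {a U : PowerSeries O} (hU : PowerSeries.X ∣ U) {m : ℕ}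
    (hm : m ≤ Fintype.card k) :
    PowerSeries.X ^ m ∣ (a + U) ^ Fintype.card k - a ^ Fintype.card k := by
  have h := map_add (FiniteField.frobeniusAlgHom k (PowerSeries O)) a U
  simp only [FiniteField.coe_frobeniusAlgHom] at h
  rw [h, add_sub_cancel_left]
  exact (pow_dvd_pow _ hm).trans (pow_dvd_pow_of_dvd hU _)

theorem exists_twisted_relation {M l : Polynomial (Polynomial k)} (hM : M.Monic)
    (hMD : M.natDegree = e + 2) (hMl : M ∈ lowDeg k (e + 2)) (hφM : φ M = 0)
    (hl : l ∈ lowDeg k 2)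
    (hz : ∀ a c : k, (M.map (Polynomial.evalRingHom a)).eval c = 0 →
      (l.map (Polynomial.evalRingHom a)).eval c = 0) {m : ℕ} (hm : m ≤ Fintype.card k) :
    ∃ (U Ψ : PowerSeries O) (B : ℕ → PowerSeries O), U ∈ weighted φ e 1 ∧
      Ψ ∈ weighted φ e (Fintype.card k * e + 2) ∧ (∀ b, B b ∈ weighted φ e (e + 3)) ∧
      PowerSeries.X ∣ U ∧ PowerSeries.coeff 1 U = φ (Polynomial.derivative M) ∧
      ∑ b ∈ Finset.range (e + 2), PowerSeries.coeff 0 (B b) * φ Polynomial.X ^ b =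
        φ l * φ (Polynomial.derivative M) ∧
      PowerSeries.X ^ m ∣ (PowerSeries.C (φ (Polynomial.C Polynomial.X) ^ Fintype.card k -
        φ (Polynomial.C Polynomial.X)) - U) * Ψ -
        ∑ b ∈ Finset.range (e + 2), B b * PowerSeries.C (φ Polynomial.X ^ Fintype.card k) ^ b := by
  obtain ⟨g, hg, H, hH⟩ := exists_auxiliary hM hMD hMl hl hz
  obtain ⟨U, T, hU, hT, hXU, hXT, hU1, hθM⟩ := exists_deformation hMl hφM m
  have hθ0 : ∀ P, PowerSeries.coeff 0 (deform φ U T P) = φ P :=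
    fun P => by
      rw [PowerSeries.coeff_zero_eq_constantCoeff_apply]
      exact constantCoeff_deform (PowerSeries.X_dvd_iff.1 hXU) (PowerSeries.X_dvd_iff.1 hXT) P
  refine ⟨U, deform φ U T g, fun b => deform φ U T (l * Polynomial.divX^[b + 1] M), hU,
    deform_mem_weighted hU hT hg, fun b => deform_mem_weighted hU hT
      (lowDeg_mono (by omega) (mul_mem_lowDeg hl (divX_iterate_mem_lowDeg hMl _))), hXU, hU1, ?_, ?_⟩
  · simp only [hθ0]
    rw [← sum_divX_iterate_mul_X_pow M hMD.le, ← map_mul, Finset.mul_sum, map_sum]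
    exact Finset.sum_congr rfl fun b _ => by rw [← map_pow, ← map_mul, mul_assoc]
  · have h1 := congrArg (deform φ U T) hH
    rw [map_mul, map_sub, map_mul, map_mul, map_sum] at h1
    simp only [map_mul, map_pow, map_sub, deform_C_X, deform_X] at h1 ⊢
    have h2 := X_pow_dvd_add_pow_card_sub (a := PowerSeries.C (φ (Polynomial.C Polynomial.X)))
      hXU hm
    have h3 : ∀ b, PowerSeries.X ^ m ∣ (PowerSeries.C (φ Polynomial.X) + T) ^
        (Fintype.card k * b) - (PowerSeries.C (φ Polynomial.X) ^ Fintype.card k) ^ b := by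
      intro b
      rw [pow_mul]
      exact (X_pow_dvd_add_pow_card_sub hXT hm).trans (sub_dvd_pow_sub_pow _ _ b)
    have h4 : PowerSeries.X ^ m ∣ ∑ b ∈ Finset.range (e + 2), deform φ U T l *
        deform φ U T (Polynomial.divX^[b + 1] M) * ((PowerSeries.C (φ Polynomial.X) + T) ^
        (Fintype.card k * b) - (PowerSeries.C (φ Polynomial.X) ^ Fintype.card k) ^ b) :=
      Finset.dvd_sum fun b _ => (h3 b).mul_left _
    have h5 := dvd_add (dvd_sub (hθM.mul_right (deform φ U T H)) (h2.mul_right (deform φ U T g))) h4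
    rw [← h1] at h5
    refine h5.trans (dvd_of_eq ?_)
    simp only [mul_sub, Finset.sum_sub_distrib, Finset.mul_sum, mul_assoc]
    ring

end TwistedRelation

section DimensionCount

variable {k : Type*} [Field k] [Fintype k]

theorem aeval_eq_zero_of_aeval_pow_card {V : Submodule k (PowerSeries k)} [Module.Finite k V]
    (hV : ∀ s ∈ V, PowerSeries.X ^ Fintype.card k ∣ s → s = 0)
    {P : MvPolynomial (PowerSeries k) (PowerSeries k)} (hP : P ∈ coeffsIn (PowerSeries k) V)
    (h : aeval (fun w : PowerSeries k => w ^ Fintype.card k) P = 0) :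
    aeval (fun w : PowerSeries k => w) P = 0 := by
  rw [aeval_def, eval₂_eq] at h ⊢
  refine sum_mul_eq_zero_of_sum_mul_pow_card hV P.support (fun s => P.coeff s) hP
    (fun s => ∏ i ∈ s.support, i ^ s i) ?_
  rw [← h]
  refine Finset.sum_congr rfl fun s _ => ?_
  rw [← Finset.prod_pow, Algebra.algebraMap_self, RingHom.id_apply]
  congr 1
  exact Finset.prod_congr rfl fun i _ => by rw [← pow_mul, ← pow_mul, mul_comm]

variable {φ : Polynomial (Polynomial k) →ₐ[k] PowerSeries k} {e : ℕ}

theorem coeff_eq_zero_of_twisted_sum_eq_zero {α m : ℕ} (hα : m * e ≤ α)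
    (hV : ∀ s ∈ lowDegValues φ (α + m + e + 2), PowerSeries.X ^ Fintype.card k ∣ s → s = 0)
    {x κ δ : PowerSeries k} (hx : x ∈ lowDegValues φ 1) (hκ : κ ≠ 0) (hδ : δ ≠ 0)
    {Ψ : ℕ → PowerSeries k} {N : ℕ → MvPolynomial (PowerSeries k) (PowerSeries k)}
    (hNm : ∀ i, N i ∈ coeffsIn (PowerSeries k) (lowDegValues φ (e + 3 + i * (e + 1))))
    (hNq : ∀ i < m, aeval (fun w : PowerSeries k => w ^ Fintype.card k) (N i) =
      (x ^ Fintype.card k - x) ^ (i + 1) * Ψ i)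
    (hN1 : ∀ i, aeval (fun w : PowerSeries k => w) (N i) = κ * δ ^ i)
    {c : ℕ → PowerSeries k} (hc : ∀ i, c i ∈ lowDegValues φ (α - i * e))
    {r : ℕ} {c' : Fin r → PowerSeries k} (hc' : ∀ j, c' j ∈ lowDegValues φ α)
    (w : Fin r → PowerSeries k) {n : ℕ} (hn : n ≤ m)
    (h : ∑ i ∈ Finset.range n, c i * Ψ i + ∑ j, c' j * w j ^ Fintype.card k = 0) :
    ∀ i < n, c i = 0 := by
  induction n with
  | zero => intro i hi; omega
  | succ n ih =>
    set z : MvPolynomial (PowerSeries k) (PowerSeries k) := X x - C x with hz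
    have hzm : z ∈ coeffsIn (PowerSeries k) (lowDegValues φ 1) :=
      Submodule.sub_mem _ (monomial_mem_coeffsIn.2 (one_mem_lowDegValues 1)) (C_mem_coeffsIn.2 hx)
    have hzpow : ∀ j, z ^ j ∈ coeffsIn (PowerSeries k) (lowDegValues φ j) := by
      intro j
      induction j with
      | zero => rw [pow_zero]; exact one_coeffsIn.2 (one_mem_lowDegValues 0)
      | succ j ih => rw [pow_succ]; exact mul_mem_coeffsIn le_rfl ih hzm
    have hzq : aeval (fun w : PowerSeries k => w ^ Fintype.card k) z =
        x ^ Fintype.card k - x := by simp [hz]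
    have hz1 : aeval (fun w : PowerSeries k => w) z = 0 := by simp [hz]
    have key := aeval_eq_zero_of_aeval_pow_card hV
      (P := ∑ i ∈ Finset.range (n + 1), C (c i) * (z ^ (n - i) * N i) +
        z ^ (n + 1) * ∑ j, C (c' j) * X (w j)) ?_ ?_
    · have h0 : c n = 0 := by
        rw [Finset.sum_range_succ, map_add, map_add, map_sum, Finset.sum_eq_zero, zero_add,
          map_mul, map_mul, map_mul, map_pow, map_pow, hz1, Nat.sub_self, pow_zero, one_mul, hN1,
          zero_pow (by omega), zero_mul, add_zero, aeval_C, Algebra.algebraMap_self,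
          RingHom.id_apply] at key
        · exact (mul_eq_zero.1 key).resolve_right (mul_ne_zero hκ (pow_ne_zero _ hδ))
        · intro i hi
          rw [Finset.mem_range] at hi
          rw [map_mul, map_mul, map_pow, hz1, zero_pow (by omega), zero_mul, mul_zero]
      rw [Finset.sum_range_succ, h0, zero_mul, add_zero] at h
      intro i hi
      rcases Nat.lt_succ_iff_lt_or_eq.1 hi with hi | rfl
      · exact ih (by omega) h i hi
      · exact h0
    · refine Submodule.add_mem _ (Submodule.sum_mem _ fun i hi => ?_) (mul_mem_coeffsIn
        (c' := α) (by omega) (hzpow _) (Submodule.sum_mem _ fun j _ => ?_))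
      · rw [Finset.mem_range] at hi
        refine mul_mem_coeffsIn ?_ (C_mem_coeffsIn.2 (hc i))
          (mul_mem_coeffsIn le_rfl (hzpow _) (hNm i))
        have h1 : i * e ≤ m * e := Nat.mul_le_mul_right _ (by omega)
        rw [mul_add, mul_one]
        omega
      · rw [mul_X_mem_coeffsIn, C_mem_coeffsIn]
        exact hc' j
    · have h1 : aeval (fun w : PowerSeries k => w ^ Fintype.card k)
          (∑ i ∈ Finset.range (n + 1), C (c i) * (z ^ (n - i) * N i)) =
          (x ^ Fintype.card k - x) ^ (n + 1) * ∑ i ∈ Finset.range (n + 1), c i * Ψ i := by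
        rw [map_sum, Finset.mul_sum]
        refine Finset.sum_congr rfl fun i hi => ?_
        rw [Finset.mem_range] at hi
        obtain ⟨s, rfl⟩ : ∃ s, n = i + s := ⟨n - i, by omega⟩
        rw [map_mul, map_mul, map_pow, hzq, hNq i (by omega), aeval_C, Algebra.algebraMap_self,
          RingHom.id_apply, Nat.add_sub_cancel_left]
        ring
      rw [map_add, h1, map_mul, map_pow, hzq, map_sum]
      simp only [map_mul, aeval_C, aeval_X, Algebra.algebraMap_self, RingHom.id_apply]
      rw [← mul_add, h, mul_zero]

theorem sum_finrank_le {α m q : ℕ} (hα : m * e ≤ α)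
    (hq : Fintype.card k = q)
    (hV : ∀ s ∈ lowDegValues φ (α + m + e + 2), PowerSeries.X ^ Fintype.card k ∣ s → s = 0)
    {x κ δ : PowerSeries k} (hx : x ∈ lowDegValues φ 1) (hκ : κ ≠ 0) (hδ : δ ≠ 0)
    {Ψ : ℕ → PowerSeries k} {N : ℕ → MvPolynomial (PowerSeries k) (PowerSeries k)}
    (hΨ : ∀ i, Ψ i ∈ lowDegValues φ (q * e + 2 + i * e))
    (hNm : ∀ i, N i ∈ coeffsIn (PowerSeries k) (lowDegValues φ (e + 3 + i * (e + 1))))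
    (hNq : ∀ i < m, aeval (fun w : PowerSeries k => w ^ Fintype.card k) (N i) =
      (x ^ Fintype.card k - x) ^ (i + 1) * Ψ i)
    (hN1 : ∀ i, aeval (fun w : PowerSeries k => w) (N i) = κ * δ ^ i) :
    ∑ i : Fin m, Module.finrank k (lowDegValues φ (α - i * e)) +
      Module.finrank k (lowDegValues φ e) * Module.finrank k (lowDegValues φ α) ≤
      Module.finrank k (lowDegValues φ (α + q * e + 2)) := by
  set b := Module.finBasis k (lowDegValues φ e) with hb
  set w : Fin (Module.finrank k (lowDegValues φ e)) → PowerSeries k := fun j => b j with hw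
  let f₁ : ((i : Fin m) → lowDegValues φ (α - i * e)) →ₗ[k] PowerSeries k :=
    ∑ i : Fin m, LinearMap.mulRight k (Ψ i) ∘ₗ Submodule.subtype _ ∘ₗ LinearMap.proj i
  let f₂ : (Fin (Module.finrank k (lowDegValues φ e)) → lowDegValues φ α) →ₗ[k] PowerSeries k :=
    ∑ j, LinearMap.mulRight k (w j ^ Fintype.card k) ∘ₗ Submodule.subtype _ ∘ₗ LinearMap.proj j
  have hf₁ : ∀ c, f₁ c = ∑ i : Fin m, (c i : PowerSeries k) * Ψ i := by intro c; simp [f₁]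
  have hf₂ : ∀ c, f₂ c = ∑ j, (c j : PowerSeries k) * w j ^ Fintype.card k := by
    intro c; simp [f₂]
  let f := LinearMap.coprod f₁ f₂
  have hf : ∀ c, f c ∈ lowDegValues φ (α + q * e + 2) := by
    rintro ⟨c, c'⟩
    rw [LinearMap.coprod_apply, hf₁, hf₂]
    refine Submodule.add_mem _ (Submodule.sum_mem _ fun i _ => ?_)
      (Submodule.sum_mem _ fun j _ => ?_)
    · refine lowDegValues_mono ?_ (mul_mem_lowDegValues (c i).2 (hΨ i))
      have h1 : (i : ℕ) * e ≤ m * e := Nat.mul_le_mul_right _ i.2.le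
      omega
    · refine lowDegValues_mono ?_ (mul_mem_lowDegValues (c' j).2 (pow_mem_lowDegValues (b j).2 _))
      rw [hq, mul_comm e]
      omega
  have hinj : Function.Injective (f.codRestrict _ hf) := by
    rw [injective_iff_map_eq_zero]
    rintro ⟨c, c'⟩ h
    have h := congrArg Subtype.val h
    rw [LinearMap.codRestrict_apply, LinearMap.coprod_apply, hf₁, hf₂] at h
    let C : ℕ → PowerSeries k := fun i => if hi : i < m then c ⟨i, hi⟩ else 0
    have hC : ∀ i : Fin m, C i = c i := fun i => by simp [C]
    have hzero : ∀ i < m, C i = 0 := by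
      refine coeff_eq_zero_of_twisted_sum_eq_zero hα hV hx hκ hδ hNm hNq hN1 (fun i => ?_)
        (fun j => (c' j).2) w le_rfl ?_
      · by_cases hi : i < m
        · simp only [C, hi, dif_pos]; exact (c ⟨i, hi⟩).2
        · simp only [C, hi, dif_neg, not_false_eq_true]; exact Submodule.zero_mem _
      · rw [← Fin.sum_univ_eq_sum_range (fun i => C i * Ψ i)]
        simp only [hC]
        exact h
    have hc0 : c = 0 := by
      funext i
      apply Subtype.ext
      rw [← hC, hzero i i.2]
      rfl
    subst hc0
    have hw0 : LinearIndependent k w :=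
      b.linearIndependent.map' (Submodule.subtype _) (Submodule.ker_subtype _)
    have h2 := eq_zero_of_sum_mul_pow_card_of_linearIndependent (V := lowDegValues φ α)
      (fun s hs => hV s (lowDegValues_mono (by omega) hs)) c' hw0 (by simpa using h)
    rw [h2]
    rfl
  have := LinearMap.finrank_le_finrank_of_injective hinj
  rw [Module.finrank_prod, Module.finrank_pi_fintype, Module.finrank_pi_fintype] at this
  simpa using this

theorem dimension_count_numeric {e α q : ℕ} {G : ℤ} (hG : 2 * G = (e + 2) * (e + 1))
    (hα : (e + 2) ^ 3 + 7 * (e + 2) ^ 2 + 23 * (e + 2) + 32 ≤ α)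
    (hq : q ≤ (e + 2) * (α + (e + 2) ^ 2 + (e + 2) + 1)) :
    ((e + 2) * (α + q * e + 2 + 1) - G : ℤ) <
      ∑ i ∈ Finset.range ((e + 2) ^ 2), ((e + 2) * (α - i * e + 1) - G : ℤ) +
        G * ((e + 2) * (α + 1) - G) := by
  have hsum : ∀ m : ℕ, 2 * ∑ i ∈ Finset.range m, ((e + 2) * (α - i * e + 1) - G : ℤ) =
      2 * m * ((e + 2) * (α + 1) - G) - (e + 2) * e * (m * (m - 1)) := by
    intro m
    induction m with
    | zero => simp
    | succ m ih => rw [Finset.sum_range_succ, mul_add, ih]; push_cast; ring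
  have hs := hsum ((e + 2) ^ 2)
  set S := ∑ i ∈ Finset.range ((e + 2) ^ 2), ((e + 2) * (α - i * e + 1) - G : ℤ) with hS
  clear_value S
  have hq' : (q : ℤ) * (e * (e + 2)) ≤
      ((e + 2) * (α + (e + 2) ^ 2 + (e + 2) + 1)) * (e * (e + 2)) :=
    mul_le_mul_of_nonneg_right (by exact_mod_cast hq) (by positivity)
  obtain ⟨s, rfl⟩ := Nat.exists_eq_add_of_le hα
  push_cast at *
  have hG1 := congrArg (· * ((e : ℤ) + 2) ^ 2) hG
  have hG2 : (2 * G) * (2 * G) = ((e + 2) * (e + 1)) * ((e + 2) * (e + 1)) := by rw [hG]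
  have hG3 : 2 * G * ((e + 2) * ((e + 2) ^ 3 + 7 * (e + 2) ^ 2 + 23 * (e + 2) + 32 + s + 1)) =
    ((e + 2) * (e + 1)) * ((e + 2) * ((e + 2) ^ 3 + 7 * (e + 2) ^ 2 + 23 * (e + 2) + 32 + s + 1)) :=
      by rw [hG]
  have hpos : ∀ i j : ℕ, 0 ≤ (e : ℤ) ^ i * s ^ j := fun i j => by positivity
  have p1 := hpos 1 0
  have p2 := hpos 2 0
  have p3 := hpos 3 0
  have p4 := hpos 4 0
  have p5 := hpos 5 0
  have p6 := hpos 6 0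
  have r0 := hpos 0 1
  have r1 := hpos 1 1
  have r2 := hpos 2 1
  have r3 := hpos 3 1
  simp only [pow_zero, mul_one, one_mul, pow_one] at p1 p2 p3 p4 p5 p6 r0 r1 r2 r3
  nlinarith

end DimensionCount

section AbstractBound

variable {k : Type*} [Field k]

theorem aeval_ne_zero_of_derivative_ne_zero {x : PowerSeries k}
    (hx : PowerSeries.derivative k x ≠ 0) {p : Polynomial k} (hp : Polynomial.aeval x p = 0) :
    p = 0 := by
  by_contra hp0
  set a := PowerSeries.constantCoeff x with ha
  obtain ⟨r, hr, hdvd⟩ := Polynomial.exists_eq_pow_rootMultiplicity_mul_and_not_dvd p hp0 a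
  have hr0 : Polynomial.aeval x r ≠ 0 := by
    intro h
    apply hdvd
    rw [Polynomial.dvd_iff_isRoot, Polynomial.IsRoot]
    have h1 : PowerSeries.constantCoeff (Polynomial.aeval x r) = r.eval a := by
      rw [Polynomial.aeval_def, Polynomial.hom_eval₂, ← ha, Polynomial.eval₂_eq_eval_map]
      congr 1
      ext i
      simp
    rw [← h1, h, map_zero]
  rw [hr, map_mul, map_pow, map_sub, Polynomial.aeval_X, Polynomial.aeval_C] at hp
  have h3 : x - algebraMap k (PowerSeries k) a = 0 := by
    have := (mul_eq_zero.1 hp).resolve_right hr0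
    exact eq_zero_of_pow_eq_zero this
  apply hx
  rw [sub_eq_zero.1 h3, Derivation.map_algebraMap]

set_option maxHeartbeats 1000000 in
theorem not_exists_branch [Fintype k] (p : ℕ) [Fact p.Prime] [CharP k p]
    {F l : Polynomial (Polynomial k)} {d : ℕ} (hF : F.Monic) (hFd : F.natDegree = d)
    (hFl : F ∈ lowDeg k d) (hq : (d + 2) ^ 4 ≤ Fintype.card k) (hl : l ∈ lowDeg k 2)
    (hz : ∀ a c : k, (F.map (Polynomial.evalRingHom a)).eval c = 0 →
      (l.map (Polynomial.evalRingHom a)).eval c = 0)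
    (φ : Polynomial (Polynomial k) →ₐ[k] PowerSeries k) (hφX : φ Polynomial.X = PowerSeries.X)
    (hφF : φ F = 0) (hx : PowerSeries.derivative k (φ (Polynomial.C Polynomial.X)) ≠ 0)
    (hφl : φ l ≠ 0) : False := by
  have hinj : ∀ r : Polynomial k, φ (Polynomial.C r) = 0 → r = 0 := by
    intro r hr
    refine aeval_ne_zero_of_derivative_ne_zero hx ?_
    have h := Polynomial.aeval_algHom_apply (φ.comp Polynomial.CAlgHom) Polynomial.X r
    simpa [hr] using h
  obtain ⟨M, hM, hMl, hker, hMF, hMd, hM1⟩ := exists_minimal_equation φ hinj hF hFd hFl hφF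
  have hφM : φ M = 0 := (hker M).2 dvd_rfl
  have hφM' := algHom_derivative_ne_zero p φ hφX hx hM hker hM1
  have hzM : ∀ a c : k, (M.map (Polynomial.evalRingHom a)).eval c = 0 →
      (l.map (Polynomial.evalRingHom a)).eval c = 0 := by
    intro a c h
    refine hz a c ?_
    obtain ⟨H, rfl⟩ := hMF
    rw [Polynomial.map_mul, Polynomial.eval_mul, h, zero_mul]
  obtain hM1' | ⟨e, he⟩ : M.natDegree = 1 ∨ ∃ e, M.natDegree = e + 2 := by
    rcases Nat.lt_or_ge 1 M.natDegree with h | h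
    · exact Or.inr ⟨M.natDegree - 2, by omega⟩
    · exact Or.inl (by omega)
  · refine hφl ((hker l).2 (dvd_of_natDegree_eq_one ?_ hM hM1' (hM1' ▸ hMl) hl hzM))
    have : 2 ^ 4 ≤ (d + 2) ^ 4 := Nat.pow_le_pow_left (by omega) 4
    omega
  rw [he] at hMl hMd
  set q := Fintype.card k with hqdef
  have hqe : (e + 4) ^ 4 ≤ q := (Nat.pow_le_pow_left (by omega) 4).trans hq
  set m := (e + 2) ^ 2 with hm
  obtain ⟨α, r, hqα, hr1, hr⟩ : ∃ α r, q = (e + 2) * (α + m + e + 2) + r ∧ 1 ≤ r ∧ r ≤ e + 2 := by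
    have h1 := Nat.div_add_mod (q - 1) (e + 2)
    have h2 := Nat.mod_lt (q - 1) (show 0 < e + 2 by omega)
    have h3 : m + e + 2 ≤ (q - 1) / (e + 2) := by
      rw [Nat.le_div_iff_mul_le (by omega)]
      have : (m + e + 2) * (e + 2) + 1 ≤ (e + 4) ^ 4 := by
        rw [hm]
        ring_nf
        nlinarith [sq_nonneg e]
      omega
    refine ⟨(q - 1) / (e + 2) - (m + e + 2), (q - 1) % (e + 2) + 1, ?_, by omega, by omega⟩
    rw [show (q - 1) / (e + 2) - (m + e + 2) + m + e + 2 = (q - 1) / (e + 2) by omega,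
      ← Nat.add_assoc, h1]
    have : 1 ≤ q := Fintype.card_pos
    omega
  have hαl : (e + 2) ^ 3 + 7 * (e + 2) ^ 2 + 23 * (e + 2) + 32 ≤ α := by
    by_contra hlt
    have h1 : α + 1 ≤ (e + 2) ^ 3 + 7 * (e + 2) ^ 2 + 23 * (e + 2) + 32 := by omega
    have h2 : (e + 2) * (α + 1) ≤
      (e + 2) * ((e + 2) ^ 3 + 7 * (e + 2) ^ 2 + 23 * (e + 2) + 32) := Nat.mul_le_mul_left _ h1
    rw [hm] at hqα
    nlinarith
  have hme : m * e ≤ α := by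
    refine le_trans ?_ hαl
    rw [hm]; nlinarith [sq_nonneg e]
  have hmq : m ≤ q := by rw [hqα]; nlinarith [Nat.zero_le ((e + 2) * (α + e + 2)), Nat.zero_le (e * m)]
  obtain ⟨U, Ψ, B, hU, hΨ, hB, hXU, hU1, hB0, hdvd⟩ :=
    exists_twisted_relation hM he hMl hφM hl hzM hmq
  choose N hNm hNq hN1 using exists_interpolating X_value_mem hU hB hXU hdvd
  have hV : ∀ s ∈ lowDegValues φ (α + m + e + 2), PowerSeries.X ^ q ∣ s → s = 0 := by
    intro s hs hdvd
    by_contra hs0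
    have := order_le_of_mem_lowDegValues hφX hM he hMl hker hs hs0 hdvd
    omega
  have hcount := sum_finrank_le hme rfl hV X_value_mem (mul_ne_zero hφl hφM') hφM'
    (Ψ := fun i => PowerSeries.coeff i Ψ) hΨ hNm hNq (fun i => by rw [hN1, hB0, hU1])
  have hfin : ∀ n, e + 1 ≤ n → (Module.finrank k (lowDegValues φ n) : ℤ) =
      (e + 2) * (n + 1) - ∑ j ∈ Finset.range (e + 2), (j : ℤ) := by
    intro n hn
    rw [finrank_lowDegValues hM he hMl hker, Nat.cast_sum]
    have : ∀ j ∈ Finset.range (e + 2), ((n + 1 - j : ℕ) : ℤ) = (n + 1) - j := by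
      intro j hj
      rw [Finset.mem_range] at hj
      omega
    rw [Finset.sum_congr rfl this, Finset.sum_sub_distrib]
    simp
  have hfine : (Module.finrank k (lowDegValues φ e) : ℤ) =
      ∑ j ∈ Finset.range (e + 2), (j : ℤ) := by
    rw [finrank_lowDegValues hM he hMl hker, ← Finset.sum_range_reflect,
      Nat.cast_sum]
    refine Finset.sum_congr rfl fun j hj => ?_
    rw [Finset.mem_range] at hj
    congr 1
    omega
  have hG : 2 * ∑ j ∈ Finset.range (e + 2), (j : ℤ) = (e + 2) * (e + 1) := by
    have := Finset.sum_range_id_mul_two (e + 2)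
    rw [mul_comm]
    have h2 := congrArg (Nat.cast : ℕ → ℤ) this
    push_cast at h2
    simpa using h2
  have hnum := dimension_count_numeric hG hαl (q := q) (by
    rw [hqα, ← hm]; nlinarith)
  have hcount' := (Nat.cast_le (α := ℤ)).2 hcount
  push_cast at hcount'
  rw [hfine, hfin α (by nlinarith), hfin (α + q * e + 2) (by nlinarith),
    Fin.sum_univ_eq_sum_range (fun i => (Module.finrank k (lowDegValues φ (α - i * e)) : ℤ)) m]
    at hcount'
  rw [Finset.sum_congr rfl fun i hi => ?_] at hcount'
  rotate_left
  · exact fun i => ((e + 2) * (α - i * e + 1) - ∑ j ∈ Finset.range (e + 2), (j : ℤ))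
  · rw [Finset.mem_range] at hi
    have h1 : i * e + e + 1 ≤ α := by
      have h2 : (i + 1) * e ≤ m * e := Nat.mul_le_mul_right e hi
      have h3 : m * e + 1 ≤ (e + 2) ^ 3 + 7 * (e + 2) ^ 2 + 23 * (e + 2) + 32 := by
        rw [hm]; nlinarith [sq_nonneg e]
      rw [add_mul, one_mul] at h2
      omega
    rw [hfin (α - i * e) (by omega), Nat.cast_sub (by omega)]
    push_cast
    rfl
  push_cast at hcount'
  exact absurd hcount' (not_le.2 hnum)

end AbstractBound

section PlanarCurve

variable {k : Type*} [Field k]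

/-- The quotient of `(X + 1) ^ i - X ^ i - 1` by `X + 1` in characteristic two. -/
def planarQuot (k : Type*) [Field k] (i : ℕ) : Polynomial k :=
  ∑ j ∈ Finset.range i, Polynomial.C ((((i - 1).choose j + 1 : ℕ) : k)) * Polynomial.X ^ j

theorem X_add_one_mul_planarQuot [CharP k 2] {i : ℕ} (hi : 1 ≤ i) :
    (Polynomial.X + 1) * planarQuot k i =
      (Polynomial.X + 1) ^ i + Polynomial.X ^ i + 1 := by
  obtain ⟨n, rfl⟩ : ∃ n, i = n + 1 := ⟨i - 1, by omega⟩
  have h : planarQuot k (n + 1) = (Polynomial.X + 1) ^ n +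
      ∑ j ∈ Finset.range (n + 1), Polynomial.X ^ j := by
    rw [planarQuot, add_pow, ← Finset.sum_add_distrib]
    refine Finset.sum_congr rfl fun j _ => ?_
    simp only [Nat.add_sub_cancel, one_pow, mul_one, Nat.cast_add, Nat.cast_one, map_add,
      Polynomial.C_1, map_natCast]
    ring
  have hg := Commute.geom_sum₂_mul (Commute.one_right (Polynomial.X : Polynomial k)) (n + 1)
  simp only [one_pow, mul_one, CharTwo.sub_eq_add] at hg
  rw [h, mul_add, mul_comm _ (∑ j ∈ _, _), hg]
  ring

theorem natDegree_planarQuot_le [CharP k 2] {i : ℕ} (hi : 3 ≤ i) :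
    (planarQuot k i).natDegree ≤ i - 2 := by
  refine Polynomial.natDegree_sum_le_of_forall_le _ _ fun j hj => ?_
  rw [Finset.mem_range] at hj
  obtain rfl | h : j = i - 1 ∨ j ≤ i - 2 := by omega
  · rw [Nat.choose_self, Nat.cast_add, Nat.cast_one, CharTwo.add_self_eq_zero]
    simp
  · exact (Polynomial.natDegree_C_mul_X_pow_le _ _).trans h

theorem natDegree_planarQuot_le_of_even [CharP k 2] {i : ℕ} (hi : 3 ≤ i) (he : Even i) :
    (planarQuot k i).natDegree ≤ i - 3 := by
  refine Polynomial.natDegree_sum_le_of_forall_le _ _ fun j hj => ?_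
  rw [Finset.mem_range] at hj
  obtain rfl | rfl | h : j = i - 1 ∨ j = i - 2 ∨ j ≤ i - 3 := by omega
  · rw [Nat.choose_self, Nat.cast_add, Nat.cast_one, CharTwo.add_self_eq_zero]
    simp
  · have h2 : (i - 1).choose (i - 2) + 1 = i := by
      rw [show i - 1 = (i - 2) + 1 by omega, Nat.choose_succ_self_right]
      omega
    rw [h2, (CharP.cast_eq_zero_iff k 2 i).2 he.two_dvd]
    simp
  · exact (Polynomial.natDegree_C_mul_X_pow_le _ _).trans h

/-- The curve of the planar function with coefficients `A`, sheared by `s`. -/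
def shearedCurve (A : ℕ → k) (d : ℕ) (s : k) : Polynomial (Polynomial k) :=
  Polynomial.X ^ (d - 2) + ∑ i ∈ Finset.Icc 3 d, Polynomial.C (Polynomial.C (A i)) *
    Polynomial.aeval (Polynomial.C Polynomial.X + Polynomial.C (Polynomial.C s) * Polynomial.X)
      (planarQuot k i) * Polynomial.X ^ (d - i)

theorem aeval_mem_lowDeg {L : Polynomial (Polynomial k)} (hL : L ∈ lowDeg k 1)
    (p : Polynomial k) : Polynomial.aeval L p ∈ lowDeg k p.natDegree := by
  rw [Polynomial.aeval_eq_sum_range]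
  refine Submodule.sum_mem _ fun i hi => Submodule.smul_mem _ _ ?_
  rw [Finset.mem_range] at hi
  exact lowDeg_mono (by omega) (pow_mem_lowDeg hL i)

theorem shear_mem_lowDeg (s : k) : Polynomial.C Polynomial.X +
    Polynomial.C (Polynomial.C s) * Polynomial.X ∈ lowDeg k 1 :=
  Submodule.add_mem _ C_X_mem_lowDeg
    (by simpa using mul_mem_lowDeg (C_C_mem_lowDeg s 0) X_mem_lowDeg)

theorem shearedCurve_mem_lowDeg [CharP k 2] (A : ℕ → k) (d : ℕ) (s : k) :
    shearedCurve A d s ∈ lowDeg k (d - 2) := by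
  refine Submodule.add_mem _ (X_pow_mem_lowDeg _) (Submodule.sum_mem _ fun i hi => ?_)
  rw [Finset.mem_Icc] at hi
  refine lowDeg_mono ?_ (mul_mem_lowDeg (mul_mem_lowDeg (C_C_mem_lowDeg _ 0)
    (aeval_mem_lowDeg (shear_mem_lowDeg s) _)) (X_pow_mem_lowDeg _))
  have := natDegree_planarQuot_le (k := k) hi.1
  omega

theorem shearedCurve_tail [CharP k 2] {A : ℕ → k} {d : ℕ} (hd : 3 ≤ d) {s : k}
    (hs : s = 0 ∨ ∀ i, Odd i → A i = 0) :
    (∑ i ∈ Finset.Icc 3 d, Polynomial.C (Polynomial.C (A i)) *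
    Polynomial.aeval (Polynomial.C Polynomial.X + Polynomial.C (Polynomial.C s) * Polynomial.X)
      (planarQuot k i) * Polynomial.X ^ (d - i)).degree < ((d - 2 : ℕ) : WithBot ℕ) := by
  refine lt_of_le_of_lt (Polynomial.degree_le_of_natDegree_le (n := d - 3) ?_)
    (by exact_mod_cast (by omega : d - 3 < d - 2))
  refine Polynomial.natDegree_sum_le_of_forall_le _ _ fun i hi => ?_
  rw [Finset.mem_Icc] at hi
  rcases hs with rfl | hs
  · have h : Polynomial.aeval (Polynomial.C Polynomial.X : Polynomial (Polynomial k))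
        (planarQuot k i) = Polynomial.C (planarQuot k i) := by
      have := Polynomial.aeval_algHom_apply (Polynomial.CAlgHom (R := k) (A := Polynomial k))
        Polynomial.X (planarQuot k i)
      simpa using this
    rw [Polynomial.C_0, Polynomial.C_0, zero_mul, add_zero, h, ← Polynomial.C_mul]
    exact (Polynomial.natDegree_C_mul_X_pow_le _ _).trans (by omega)
  · rcases Nat.even_or_odd i with he | ho
    · refine natDegree_le_of_mem_lowDeg (lowDeg_mono ?_ (mul_mem_lowDeg (mul_mem_lowDeg
        (C_C_mem_lowDeg _ 0) (aeval_mem_lowDeg (shear_mem_lowDeg s) _)) (X_pow_mem_lowDeg _)))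
      have := natDegree_planarQuot_le_of_even (k := k) hi.1 he
      omega
    · simp [hs i ho]

theorem eval_shearedCurve (A : ℕ → k) (d : ℕ) (s a c : k) :
    ((shearedCurve A d s).map (Polynomial.evalRingHom a)).eval c = c ^ (d - 2) +
      ∑ i ∈ Finset.Icc 3 d, A i * (planarQuot k i).eval (a + s * c) * c ^ (d - i) := by
  have h (p : Polynomial k) (L : Polynomial (Polynomial k)) :
      ((Polynomial.aeval L p).map (Polynomial.evalRingHom a)).eval c =
        p.eval ((L.map (Polynomial.evalRingHom a)).eval c) := by
    induction p using Polynomial.induction_on' with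
    | add p q hp hq => simp [hp, hq]
    | monomial n b =>
      simp [Polynomial.aeval_monomial, Polynomial.algebraMap_apply]
  simp [shearedCurve, Polynomial.map_sum, Polynomial.eval_finsetSum, h]

theorem sum_pow_eq_mul_sum_planarQuot [CharP k 2] {A : ℕ → k} (d : ℕ)
    (hA1 : A 1 = 0) (hA2 : A 2 = 0) (a δ : k) :
    ∑ i ∈ Finset.range (d + 1),
      A i * ((a * δ) ^ i + δ ^ i + ((a + 1) * δ) ^ i + 0 ^ i) =
    (a + 1) * ∑ i ∈ Finset.Icc 3 d, A i * (planarQuot k i).eval a * δ ^ i := by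
  have h2 : (2 : k) = 0 := CharTwo.two_eq_zero
  have hsub : Finset.Icc 3 d ⊆ Finset.range (d + 1) := fun i hi => by
    rw [Finset.mem_Icc] at hi
    rw [Finset.mem_range]
    omega
  rw [← Finset.sum_subset hsub, Finset.mul_sum]
  · refine Finset.sum_congr rfl fun i hi => ?_
    rw [Finset.mem_Icc] at hi
    have := congrArg (Polynomial.eval a) (X_add_one_mul_planarQuot (k := k) (i := i) (by omega))
    simp only [Polynomial.eval_mul, Polynomial.eval_add, Polynomial.eval_X, Polynomial.eval_one,
      Polynomial.eval_pow] at this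
    rw [zero_pow (by omega), mul_pow, mul_pow]
    linear_combination (-A i * δ ^ i) * this
  · intro i hi hi'
    rw [Finset.mem_range] at hi
    rw [Finset.mem_Icc] at hi'
    obtain rfl | rfl | rfl : i = 0 ∨ i = 1 ∨ i = 2 := by omega
    · simp only [pow_zero]
      linear_combination 2 * A 0 * h2
    · rw [hA1, zero_mul]
    · rw [hA2, zero_mul]

theorem eval_eq_zero_of_planar [CharP k 2] {f : Polynomial k} {d : ℕ} (hf : f.natDegree = d)
    (hd : 3 ≤ d) (hA1 : f.coeff 1 = 0) (hA2 : f.coeff 2 = 0)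
    (hplanar : ∀ ε : k, ε ≠ 0 →
      Function.Injective fun x : k => f.eval (x + ε) + f.eval x + ε * x) {a c : k}
    (h : c ^ (d - 2) +
      ∑ i ∈ Finset.Icc 3 d, f.coeff i * (planarQuot k i).eval a * c ^ (d - i) = 0) :
    (a + 1) * c = 0 := by
  by_contra hne
  obtain ⟨ha, hc⟩ := mul_ne_zero_iff.1 hne
  have h2 : (2 : k) = 0 := CharTwo.two_eq_zero
  have hsum : ∑ i ∈ Finset.Icc 3 d, f.coeff i * (planarQuot k i).eval a * c⁻¹ ^ i = c⁻¹ ^ 2 := by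
    have h1 : ∑ i ∈ Finset.Icc 3 d, f.coeff i * (planarQuot k i).eval a * c⁻¹ ^ i = c⁻¹ ^ d *
        ∑ i ∈ Finset.Icc 3 d, f.coeff i * (planarQuot k i).eval a * c ^ (d - i) := by
      rw [Finset.mul_sum]
      refine Finset.sum_congr rfl fun i hi => ?_
      rw [Finset.mem_Icc] at hi
      have : c⁻¹ ^ d * c ^ (d - i) = c⁻¹ ^ i := by
        rw [← Nat.sub_add_cancel hi.2, pow_add, Nat.add_sub_cancel, mul_right_comm, ← mul_pow,
          inv_mul_cancel₀ hc, one_pow, one_mul]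
      rw [← this]
      ring
    have h3 : c⁻¹ ^ d * c ^ (d - 2) = c⁻¹ ^ 2 := by
      obtain ⟨n, rfl⟩ : ∃ n, d = n + 2 := ⟨d - 2, by omega⟩
      rw [Nat.add_sub_cancel, pow_add, mul_right_comm, ← mul_pow, inv_mul_cancel₀ hc, one_pow,
        one_mul]
    rw [h1]
    linear_combination c⁻¹ ^ d * h - h3 - c⁻¹ ^ 2 * h2
  have hkey := sum_pow_eq_mul_sum_planarQuot d hA1 hA2 a c⁻¹
  rw [hsum] at hkey
  simp only [mul_add, Finset.sum_add_distrib] at hkey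
  rw [← hf] at hkey
  simp only [← Polynomial.eval_eq_sum_range] at hkey
  refine inv_ne_zero hc (hplanar ((a + 1) * c⁻¹) (mul_ne_zero ha (inv_ne_zero hc)) ?_)
  have e1 : c⁻¹ + (a + 1) * c⁻¹ = a * c⁻¹ := by linear_combination c⁻¹ * h2
  simp only [e1, zero_add, mul_zero, add_zero]
  linear_combination hkey - (Polynomial.eval ((a + 1) * c⁻¹) f + Polynomial.eval 0 f) * h2 +
    (a + 1) * c⁻¹ ^ 2 * h2

theorem no_series_solution [Fintype k] [CharP k 2] {f : Polynomial k} {d : ℕ}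
    (hf : f.natDegree = d) (hd : 3 ≤ d) (hq : d ^ 4 ≤ Fintype.card k)
    (hA1 : f.coeff 1 = 0) (hA2 : f.coeff 2 = 0)
    (hplanar : ∀ ε : k, ε ≠ 0 →
      Function.Injective fun x : k => f.eval (x + ε) + f.eval x + ε * x)
    {s : k} (hs : s = 0 ∨ ∀ i, Odd i → f.coeff i = 0) {x : PowerSeries k} (hx1 : x ≠ 1)
    (hx : PowerSeries.derivative k x ≠ PowerSeries.C s) :
    PowerSeries.X ^ (d - 2) + ∑ i ∈ Finset.Icc 3 d, PowerSeries.C (f.coeff i) *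
      Polynomial.aeval x (planarQuot k i) * PowerSeries.X ^ (d - i) ≠ 0 := by
  intro h
  have : Fact (Nat.Prime 2) := ⟨Nat.prime_two⟩
  have h2 : (2 : PowerSeries k) = 0 := by
    rw [← map_ofNat (PowerSeries.C (R := k)), CharTwo.two_eq_zero, map_zero]
  have htail := shearedCurve_tail (A := fun i => f.coeff i) hd hs
  have hdeg : (shearedCurve (fun i => f.coeff i) d s).natDegree = d - 2 :=
    Polynomial.natDegree_eq_of_degree_eq_some (by
      rw [shearedCurve, Polynomial.degree_add_eq_left_of_degree_lt (by
        rwa [Polynomial.degree_X_pow]), Polynomial.degree_X_pow])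
  let φ : Polynomial (Polynomial k) →ₐ[k] PowerSeries k :=
    Polynomial.aevalAeval (x + PowerSeries.C s * PowerSeries.X) PowerSeries.X
  have hφX : φ (Polynomial.C Polynomial.X) = x + PowerSeries.C s * PowerSeries.X :=
    Polynomial.aevalAeval_X _ _
  have hφY : φ Polynomial.X = PowerSeries.X := Polynomial.aevalAeval_Y _ _
  have hφC (c : k) : φ (Polynomial.C (Polynomial.C c)) = PowerSeries.C c := by
    exact φ.commutes c
  have hφL : φ (Polynomial.C Polynomial.X + Polynomial.C (Polynomial.C s) * Polynomial.X) = x := by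
    rw [map_add, map_mul, hφX, hφC, hφY]
    linear_combination PowerSeries.C s * PowerSeries.X * h2
  refine not_exists_branch 2 (F := shearedCurve (fun i => f.coeff i) d s)
    (l := (Polynomial.C Polynomial.X + Polynomial.C (Polynomial.C s) * Polynomial.X + 1) *
      Polynomial.X) (d := d - 2) (Polynomial.monic_X_pow_add htail)
    hdeg (shearedCurve_mem_lowDeg _ _ _) ?_ ?_ ?_ φ hφY ?_ ?_ ?_
  · rwa [Nat.sub_add_cancel (by omega)]
  · exact mul_mem_lowDeg (Submodule.add_mem _ (shear_mem_lowDeg s) (one_mem_lowDeg 1))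
      X_mem_lowDeg
  · intro a c hac
    rw [eval_shearedCurve] at hac
    simpa using eval_eq_zero_of_planar hf hd hA1 hA2 hplanar hac
  · rw [shearedCurve, map_add, map_sum, map_pow, hφY, ← h]
    congr 1
    refine Finset.sum_congr rfl fun i _ => ?_
    rw [map_mul, map_mul, map_pow, hφC, hφY, ← Polynomial.aeval_algHom_apply, hφL]
  · rw [hφX]
    intro h0
    apply hx
    rw [map_add, Derivation.leibniz] at h0
    simp at h0
    linear_combination h0 - PowerSeries.C s * h2
  · rw [map_mul, map_add, hφL, hφY, map_one]
    refine mul_ne_zero (fun h0 => hx1 ?_) PowerSeries.X_ne_zero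
    linear_combination h0 - h2
end PlanarCurve

section Expansion

variable {k : Type*} [Field k]

theorem PowerSeries.exists_fixedPoint_of_contracting (T : PowerSeries k → PowerSeries k)
    (hT : ∀ a b n, PowerSeries.X ^ n ∣ a - b → PowerSeries.X ^ (n + 1) ∣ T a - T b) :
    ∃ a, T a = a := by
  set s : ℕ → PowerSeries k := fun n => T^[n] 0 with hs
  have hs1 (n : ℕ) : s (n + 1) = T (s n) := Function.iterate_succ_apply' T n 0
  have hstep (n : ℕ) : PowerSeries.X ^ n ∣ s (n + 1) - s n := by
    induction n with
    | zero => simp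
    | succ n ih => rw [hs1 (n + 1), hs1 n]; exact hT _ _ _ (hs1 n ▸ ih)
  have hle (n m : ℕ) : PowerSeries.X ^ n ∣ s (n + m) - s n := by
    induction m with
    | zero => simp
    | succ m ih =>
      have := dvd_add ((pow_dvd_pow _ (Nat.le_add_right n m)).trans (hstep (n + m))) ih
      rwa [sub_add_sub_cancel] at this
  set a : PowerSeries k := PowerSeries.mk fun n => PowerSeries.coeff n (s (n + 1)) with ha
  have hlim (n : ℕ) : PowerSeries.X ^ n ∣ a - s n := by
    rw [PowerSeries.X_pow_dvd_iff]
    intro m hm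
    have h := PowerSeries.X_pow_dvd_iff.1 (hle (m + 1) (n - (m + 1))) m (Nat.lt_succ_self m)
    rw [show m + 1 + (n - (m + 1)) = n by omega, map_sub, sub_eq_zero] at h
    rw [map_sub, ha, PowerSeries.coeff_mk, h, sub_self]
  refine ⟨a, sub_eq_zero.1 ?_⟩
  ext n
  have h1 := hT _ _ _ (hlim n)
  have h2 := dvd_sub h1 (hlim (n + 1))
  rw [hs1, sub_sub_sub_cancel_right] at h2
  simpa using PowerSeries.X_pow_dvd_iff.1 h2 n (Nat.lt_succ_self n)

/-- `T ζ` is `X ^ N` times a power series which modulo `X` is the affine function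
`c₀ + c₁ ζ`. -/
def HasAffineLeadingTerm (T : PowerSeries k → PowerSeries k) (N : ℕ) (c₀ c₁ : k) : Prop :=
  ∃ R : Polynomial (PowerSeries k), ∀ ζ, T ζ =
    PowerSeries.X ^ N * (PowerSeries.C c₀ + PowerSeries.C c₁ * ζ + PowerSeries.X * R.eval ζ)

theorem HasAffineLeadingTerm.exists_root {T : PowerSeries k → PowerSeries k} {N : ℕ} {c₀ c₁ : k}
    (h : HasAffineLeadingTerm T N c₀ c₁) (h₀ : c₀ ≠ 0) (h₁ : c₁ ≠ 0) :
    ∃ ζ, T ζ = 0 ∧ PowerSeries.constantCoeff ζ ≠ 0 := by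
  obtain ⟨R, hR⟩ := h
  obtain ⟨ζ, hζ⟩ := PowerSeries.exists_fixedPoint_of_contracting
    (fun ζ => -(PowerSeries.C c₁⁻¹ * (PowerSeries.C c₀ + PowerSeries.X * R.eval ζ)))
    (fun a b n hab => by
      have : -(PowerSeries.C c₁⁻¹ * (PowerSeries.C c₀ + PowerSeries.X * R.eval a)) -
          -(PowerSeries.C c₁⁻¹ * (PowerSeries.C c₀ + PowerSeries.X * R.eval b)) =
          -PowerSeries.C c₁⁻¹ * ((R.eval a - R.eval b) * PowerSeries.X) := by ring
      rw [this, pow_succ]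
      exact dvd_mul_of_dvd_right
        (mul_dvd_mul_right (hab.trans (Polynomial.sub_dvd_eval_sub a b R)) _) _)
  have hc : PowerSeries.C c₁ * PowerSeries.C c₁⁻¹ = (1 : PowerSeries k) := by
    rw [← map_mul, mul_inv_cancel₀ h₁, map_one]
  have hz : PowerSeries.C c₀ + PowerSeries.C c₁ * ζ + PowerSeries.X * R.eval ζ = 0 := by
    linear_combination (-PowerSeries.C c₁) * hζ -
      (PowerSeries.C c₀ + PowerSeries.X * R.eval ζ) * hc
  refine ⟨ζ, by rw [hR, hz, mul_zero], fun h0 => h₀ ?_⟩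
  simpa [h0] using congrArg PowerSeries.constantCoeff hz

theorem HasAffineLeadingTerm.add {T T' : PowerSeries k → PowerSeries k} {N : ℕ}
    {c₀ c₁ c₀' c₁' : k} (h : HasAffineLeadingTerm T N c₀ c₁)
    (h' : HasAffineLeadingTerm T' N c₀' c₁') :
    HasAffineLeadingTerm (fun ζ => T ζ + T' ζ) N (c₀ + c₀') (c₁ + c₁') := by
  obtain ⟨R, hR⟩ := h
  obtain ⟨R', hR'⟩ := h'
  refine ⟨R + R', fun ζ => ?_⟩
  simp only [hR, hR', map_add, Polynomial.eval_add]
  ring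

theorem HasAffineLeadingTerm.zero (N : ℕ) :
    HasAffineLeadingTerm (fun _ => (0 : PowerSeries k)) N 0 0 :=
  ⟨0, fun ζ => by simp⟩

theorem HasAffineLeadingTerm.sum {ι : Type*} (S : Finset ι) {T : ι → PowerSeries k → PowerSeries k}
    {N : ℕ} {c₀ c₁ : ι → k} (h : ∀ i ∈ S, HasAffineLeadingTerm (T i) N (c₀ i) (c₁ i)) :
    HasAffineLeadingTerm (fun ζ => ∑ i ∈ S, T i ζ) N (∑ i ∈ S, c₀ i) (∑ i ∈ S, c₁ i) := by
  classical
  induction S using Finset.induction_on with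
  | empty => simpa using HasAffineLeadingTerm.zero N
  | insert i S hi ih =>
    simp only [Finset.sum_insert hi]
    exact (h i (Finset.mem_insert_self i S)).add
      (ih fun j hj => h j (Finset.mem_insert_of_mem hj))

theorem HasAffineLeadingTerm.of_lt {T : PowerSeries k → PowerSeries k} {N M : ℕ} (hNM : N < M)
    (R : Polynomial (PowerSeries k)) (h : ∀ ζ, T ζ = PowerSeries.X ^ M * R.eval ζ) :
    HasAffineLeadingTerm T N 0 0 := by
  obtain ⟨m, rfl⟩ : ∃ m, M = N + (m + 1) := ⟨M - (N + 1), by omega⟩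
  refine ⟨Polynomial.C (PowerSeries.X ^ m) * R, fun ζ => ?_⟩
  rw [h]
  simp only [map_zero, Polynomial.eval_mul, Polynomial.eval_C]
  ring

theorem not_hasAffineLeadingTerm [Fintype k] [CharP k 2] {f : Polynomial k} {d : ℕ}
    (hf : f.natDegree = d) (hd : 3 ≤ d) (hq : d ^ 4 ≤ Fintype.card k)
    (hA1 : f.coeff 1 = 0) (hA2 : f.coeff 2 = 0)
    (hplanar : ∀ ε : k, ε ≠ 0 →
      Function.Injective fun x : k => f.eval (x + ε) + f.eval x + ε * x)
    {x₀ : k} {e N : ℕ} {c₀ c₁ : k} (h₀ : c₀ ≠ 0) (h₁ : c₁ ≠ 0) (he : 1 ≤ e)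
    (hs : Odd e ∨ 2 ≤ e ∧ ∀ i, Odd i → f.coeff i = 0) :
    ¬ HasAffineLeadingTerm (fun ζ => PowerSeries.X ^ (d - 2) +
      ∑ i ∈ Finset.Icc 3 d, PowerSeries.C (f.coeff i) * Polynomial.aeval
        (PowerSeries.C x₀ + ζ * PowerSeries.X ^ e) (planarQuot k i) * PowerSeries.X ^ (d - i))
      N c₀ c₁ := by
  intro h
  obtain ⟨ζ, hζ, hζ0⟩ := h.exists_root h₀ h₁
  have hζne : ζ ≠ 0 := fun h => hζ0 (by rw [h, map_zero])
  have hx1 : PowerSeries.C x₀ + ζ * PowerSeries.X ^ e ≠ 1 := by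
    intro h1
    have h2 := congrArg PowerSeries.constantCoeff h1
    rw [map_add, map_mul, map_pow, PowerSeries.constantCoeff_X, zero_pow (by omega),
      PowerSeries.constantCoeff_C, mul_zero, add_zero, map_one] at h2
    rw [h2, map_one, add_eq_left] at h1
    exact mul_ne_zero hζne (pow_ne_zero _ PowerSeries.X_ne_zero) h1
  rcases hs with ho | ⟨he2, hs⟩
  · refine no_series_solution hf hd hq hA1 hA2 hplanar (s := 0) (Or.inl rfl) hx1 ?_ hζ
    intro h0
    have := congrArg (PowerSeries.coeff (e - 1)) h0
    rw [PowerSeries.coeff_derivative, Nat.sub_add_cancel he, map_add, PowerSeries.coeff_C,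
      if_neg (by omega), PowerSeries.coeff_mul_X_pow', if_pos le_rfl, Nat.sub_self, map_zero,
      map_zero, zero_add, ← Nat.cast_add_one, Nat.sub_add_cancel he,
      PowerSeries.coeff_zero_eq_constantCoeff_apply] at this
    have hek := (CharP.cast_eq_zero_iff k 2 e).1 ((mul_eq_zero.1 this).resolve_left hζ0)
    exact (Nat.not_even_iff_odd.2 ho) (even_iff_two_dvd.2 hek)
  · refine no_series_solution hf hd hq hA1 hA2 hplanar (s := 1) (Or.inr hs) hx1 ?_ hζ
    intro h0
    have := congrArg (PowerSeries.coeff 0) h0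
    rw [PowerSeries.coeff_derivative, zero_add, map_add, PowerSeries.coeff_C,
      if_neg one_ne_zero, PowerSeries.coeff_mul_X_pow', if_neg (by omega)] at this
    simp at this

theorem choose_two_pow_mul_sub_one_modEq (u : ℕ) {n : ℕ} (hn : 1 ≤ n) :
    (2 ^ u * n - 1).choose (2 ^ u) ≡ n - 1 [MOD 2] := by
  have : Fact (Nat.Prime 2) := ⟨Nat.prime_two⟩
  induction u with
  | zero => simp [Nat.ModEq]
  | succ u ih =>
    have h := Choose.choose_modEq_choose_mod_mul_choose_div_nat
      (n := 2 ^ (u + 1) * n - 1) (k := 2 ^ (u + 1)) (p := 2)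
    have h1 : 1 ≤ 2 ^ u * n := Nat.mul_pos (by positivity) hn
    have h2 : 2 ^ (u + 1) * n = 2 * (2 ^ u * n) := by ring
    rw [h2, show (2 * (2 ^ u * n) - 1) % 2 = 1 by omega,
      show (2 * (2 ^ u * n) - 1) / 2 = 2 ^ u * n - 1 by omega, pow_succ', Nat.mul_mod_right,
      Nat.mul_div_cancel_left _ two_pos, Nat.choose_zero_right, one_mul] at h
    rw [h2, pow_succ']
    exact h.trans ih

theorem cast_choose_two_pow_add_one [CharP k 2] (u : ℕ) {n : ℕ} (hn : 1 ≤ n) :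
    (((2 ^ u * n - 1).choose (2 ^ u) + 1 : ℕ) : k) = n := by
  rw [CharP.natCast_eq_natCast _ 2]
  have := (choose_two_pow_mul_sub_one_modEq u hn).add_right 1
  rwa [Nat.sub_add_cancel hn] at this

theorem natCast_eq_one_of_odd {R : Type*} [Ring R] [CharP R 2] {n : ℕ} (hn : Odd n) :
    (n : R) = 1 := by
  rw [← Nat.cast_one, CharP.natCast_eq_natCast _ 2]
  exact Nat.odd_iff.1 hn

theorem planarQuot_comp_X_add_one [CharP k 2] (v : ℕ) {m : ℕ} (hm : 2 ≤ m) (ho : Odd m) :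
    ∃ H : Polynomial k, (planarQuot k (2 ^ v * m)).comp (Polynomial.X + 1) =
      Polynomial.X ^ (2 ^ v - 1) * (1 + Polynomial.X * H) := by
  have h2 : (2 : Polynomial k) = 0 := CharTwo.two_eq_zero
  have hv : 1 ≤ 2 ^ v := Nat.one_le_two_pow
  obtain ⟨S, hS⟩ : ∃ S : Polynomial k, (Polynomial.X + 1) ^ (2 ^ v * m) =
      1 + Polynomial.X ^ (2 ^ v) + Polynomial.X ^ (2 * 2 ^ v) * S := by
    have : Fact (Nat.Prime 2) := ⟨Nat.prime_two⟩
    obtain ⟨S, hS⟩ := Polynomial.powAddExpansion 1 (Polynomial.X ^ 2 ^ v : Polynomial k) m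
    refine ⟨S, ?_⟩
    rw [pow_mul, add_pow_char_pow, one_pow, add_comm, hS, natCast_eq_one_of_odd ho]
    ring
  obtain ⟨w, hw⟩ : ∃ w, 2 ^ v * m = 2 ^ v + (w + 1) := ⟨2 ^ v * m - 2 ^ v - 1, by
    have := Nat.mul_le_mul_left (2 ^ v) hm
    omega⟩
  obtain ⟨v', hv'⟩ : ∃ v', 2 ^ v = v' + 1 := ⟨2 ^ v - 1, by omega⟩
  refine ⟨Polynomial.X ^ w + Polynomial.X ^ v' * S, ?_⟩
  have h := congrArg (fun p => p.comp (Polynomial.X + 1))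
    (X_add_one_mul_planarQuot (k := k) (i := 2 ^ v * m) (by nlinarith))
  simp only [Polynomial.mul_comp, Polynomial.add_comp, Polynomial.pow_comp, Polynomial.X_comp,
    Polynomial.one_comp] at h
  apply mul_left_cancel₀ (Polynomial.X_ne_zero (R := k))
  rw [show (Polynomial.X + 1 + 1 : Polynomial k) = Polynomial.X by linear_combination h2, hS] at h
  rw [h, hw, hv', Nat.add_sub_cancel]
  linear_combination h2

theorem eval_aeval (Z : Polynomial (PowerSeries k)) (H : Polynomial k) (ζ : PowerSeries k) :
    (Polynomial.aeval Z H).eval ζ = Polynomial.aeval (Z.eval ζ) H := by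
  induction H using Polynomial.induction_on' with
  | add p q hp hq => simp [hp, hq]
  | monomial n b => simp [Polynomial.aeval_monomial, Polynomial.algebraMap_apply]

theorem coeff_add_three_eq_zero [Fintype k] [CharP k 2] {f : Polynomial k} {d : ℕ}
    (hf : f.natDegree = d) (hd : 3 ≤ d) (hq : d ^ 4 ≤ Fintype.card k)
    (hA1 : f.coeff 1 = 0) (hA2 : f.coeff 2 = 0)
    (hplanar : ∀ ε : k, ε ≠ 0 →
      Function.Injective fun x : k => f.eval (x + ε) + f.eval x + ε * x)
    {t : ℕ} (ht : Even t) (ht1 : 1 ≤ t) (htd : t + 3 ≤ d)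
    (hS : ∀ i j, 3 ≤ i → i ≤ d → j < i → f.coeff i ≠ 0 →
      ((((i - 1).choose j + 1 : ℕ) : k)) ≠ 0 → i ≤ t * j + 3) :
    f.coeff (t + 3) = 0 := by
  by_contra hne
  refine not_hasAffineLeadingTerm hf hd hq hA1 hA2 hplanar (x₀ := 0) (e := t + 1) (N := d - 2)
    (one_ne_zero (α := k)) hne (by omega) (Or.inl ht.add_one) ?_
  have hodd : Odd (t + 3) := by
    obtain ⟨r, rfl⟩ := ht
    exact ⟨r + 1, by ring⟩
  have hX : HasAffineLeadingTerm (fun _ => (PowerSeries.X : PowerSeries k) ^ (d - 2))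
      (d - 2) 1 0 := ⟨0, fun ζ => by simp⟩
  have hsum := HasAffineLeadingTerm.sum (Finset.Icc 3 d)
    (T := fun i ζ => PowerSeries.C (f.coeff i) * Polynomial.aeval
        (PowerSeries.C (0 : k) + ζ * PowerSeries.X ^ (t + 1)) (planarQuot k i) *
        PowerSeries.X ^ (d - i)) (N := d - 2) (c₀ := fun _ => 0)
    (c₁ := fun i => if i = t + 3 then f.coeff i else 0) ?_
  · have := hX.add hsum
    rw [Finset.sum_ite_eq', if_pos (Finset.mem_Icc.2 ⟨by omega, htd⟩), Finset.sum_const_zero] at this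
    simpa using this
  intro i hi
  rw [Finset.mem_Icc] at hi
  have hterm := HasAffineLeadingTerm.sum (Finset.range i)
    (T := fun j ζ => PowerSeries.C (f.coeff i) *
      (PowerSeries.C (((i - 1).choose j + 1 : ℕ) : k) *
        (ζ * PowerSeries.X ^ (t + 1)) ^ j) * PowerSeries.X ^ (d - i)) (N := d - 2) (c₀ := fun _ => 0)
    (c₁ := fun j => if j = 1 then (if i = t + 3 then f.coeff i else 0) else 0) ?_
  · rw [Finset.sum_ite_eq', if_pos (Finset.mem_range.2 (by omega)), Finset.sum_const_zero] at hterm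
    convert hterm using 2 with ζ
    rw [planarQuot, map_sum, Finset.mul_sum, Finset.sum_mul]
    refine Finset.sum_congr rfl fun j _ => ?_
    rw [map_zero, zero_add, map_mul, map_pow, Polynomial.aeval_X, Polynomial.aeval_C]
    rfl
  intro j hj
  rw [Finset.mem_range] at hj
  by_cases hA : f.coeff i = 0
  · simpa [hA] using HasAffineLeadingTerm.zero (k := k) (d - 2)
  by_cases hc : ((((i - 1).choose j + 1 : ℕ) : k)) = 0
  · have hnot : ¬ (j = 1 ∧ i = t + 3) := by
      rintro ⟨rfl, rfl⟩
      rw [Nat.choose_one_right, Nat.sub_add_cancel (by omega), natCast_eq_one_of_odd hodd] at hc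
      exact one_ne_zero hc
    have h0 : (if j = 1 then (if i = t + 3 then f.coeff i else 0) else 0) = 0 := by
      rw [← ite_and, if_neg hnot]
    simpa only [hc, h0, map_zero, zero_mul, mul_zero] using
      HasAffineLeadingTerm.zero (k := k) (d - 2)
  have hle := hS i j hi.1 hi.2 hj hA hc
  have hj0 : j ≠ 0 := by
    rintro rfl
    apply hc
    rw [Nat.choose_zero_right, Nat.cast_add, Nat.cast_one, CharTwo.add_self_eq_zero]
  by_cases hlead : j = 1 ∧ i = t + 3
  · obtain ⟨rfl, rfl⟩ := hlead
    refine ⟨0, fun ζ => ?_⟩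
    rw [if_pos rfl, if_pos rfl, Nat.choose_one_right, Nat.sub_add_cancel (by omega),
      natCast_eq_one_of_odd hodd, show d - 2 = (t + 1) + (d - (t + 3)) by omega, pow_add]
    simp only [map_one, map_zero, Polynomial.eval_zero]
    ring
  · have h0 : (if j = 1 then (if i = t + 3 then f.coeff i else 0) else 0) = 0 := by
      rw [← ite_and, if_neg hlead]
    rw [h0]
    have hlt : d - 2 < (t + 1) * j + (d - i) := by
      have h1 : (t + 1) * j = t * j + j := by ring
      obtain rfl | h2 : j = 1 ∨ 2 ≤ j := by omega
      · omega
      · omega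
    refine HasAffineLeadingTerm.of_lt hlt (Polynomial.C (PowerSeries.C (f.coeff i) *
      PowerSeries.C (((i - 1).choose j + 1 : ℕ) : k)) * Polynomial.X ^ j) fun ζ => ?_
    simp only [Polynomial.eval_mul, Polynomial.eval_C, Polynomial.eval_pow, Polynomial.eval_X]
    ring

theorem coeff_two_mul_add_four_eq_zero_aux [Fintype k] [CharP k 2] {f : Polynomial k} {d : ℕ}
    (hf : f.natDegree = d) (hd : 3 ≤ d) (hq : d ^ 4 ≤ Fintype.card k)
    (h2pow : ∀ v : ℕ, f.coeff (2 ^ v) = 0)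
    (hplanar : ∀ ε : k, ε ≠ 0 →
      Function.Injective fun x : k => f.eval (x + ε) + f.eval x + ε * x)
    {t o : ℕ} (ht : Odd t) (htd : 2 * t + 4 ≤ d)
    (ho : o = 2 ∨ 3 ≤ o ∧ Odd o ∧ f.coeff o ≠ 0) (hot : o ≤ t + 2)
    (hodd : ∀ i, Odd i → f.coeff i ≠ 0 → 3 ≤ i ∧ i ≤ o)
    (hS : ∀ i j, 3 ≤ i → i ≤ d → j < i → f.coeff i ≠ 0 →
      ((((i - 1).choose j + 1 : ℕ) : k)) ≠ 0 → i ≤ (t + 1) * j + 2) :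
    f.coeff (2 * t + 4) = 0 := by
  by_contra hne
  have hA1 : f.coeff 1 = 0 := by simpa using h2pow 0
  have hA2 : f.coeff 2 = 0 := by simpa using h2pow 1
  have h0 : (if o = 2 then (1 : k) else f.coeff o) ≠ 0 := by
    split_ifs with h
    · exact one_ne_zero
    · exact (ho.resolve_left h).2.2
  obtain ⟨e, he⟩ : ∃ e, e + o = 2 * t + 4 := ⟨2 * t + 4 - o, by omega⟩
  refine not_hasAffineLeadingTerm hf hd hq hA1 hA2 hplanar (x₀ := 1) (e := e)
    (N := d - o) h0 hne (by omega) ?_ ?_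
  · rcases ho with rfl | ⟨_, h, _⟩
    · refine Or.inr ⟨by omega, fun i hi => ?_⟩
      by_contra hi0
      have := hodd i hi hi0
      omega
    · left
      obtain ⟨r, rfl⟩ := h
      rw [Nat.odd_iff]
      omega
  have hX : HasAffineLeadingTerm (fun _ => (PowerSeries.X : PowerSeries k) ^ (d - 2))
      (d - o) (if o = 2 then 1 else 0) 0 := by
    split_ifs with h
    · exact ⟨0, fun ζ => by simp [h]⟩
    · exact HasAffineLeadingTerm.of_lt (M := d - 2) (by omega) 1 fun ζ => by simp
  have hsum := HasAffineLeadingTerm.sum (Finset.Icc 3 d)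
    (T := fun i ζ => PowerSeries.C (f.coeff i) * Polynomial.aeval
        (PowerSeries.C (1 : k) + ζ * PowerSeries.X ^ e) (planarQuot k i) *
        PowerSeries.X ^ (d - i)) (N := d - o) (c₀ := fun i => if i = o then f.coeff i else 0)
    (c₁ := fun i => if i = 2 * t + 4 then f.coeff i else 0) ?_
  · have := hX.add hsum
    rw [Finset.sum_ite_eq', Finset.sum_ite_eq', if_pos (Finset.mem_Icc.2 ⟨by omega, htd⟩),
      zero_add] at this
    convert this using 1
    rcases ho with rfl | ⟨h, _⟩
    · simp
    · rw [if_neg (by omega), if_neg (by omega), if_pos (Finset.mem_Icc.2 ⟨h, by omega⟩), zero_add]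
  intro i hi
  rw [Finset.mem_Icc] at hi
  by_cases hA : f.coeff i = 0
  · simpa [hA] using HasAffineLeadingTerm.zero (k := k) (d - o)
  obtain ⟨v, m, hm, him⟩ := Nat.exists_eq_two_pow_mul_odd (n := i) (by omega)
  have hm3 : 3 ≤ m := by
    obtain ⟨r, rfl⟩ := hm
    rcases r with _ | r
    · exact absurd (by simpa [him] using h2pow v) hA
    · omega
  have hm1 : (m : k) ≠ 0 := by rw [natCast_eq_one_of_odd hm]; exact one_ne_zero
  have hv1 : 1 ≤ 2 ^ v := Nat.one_le_two_pow
  have hle : i ≤ (t + 1) * 2 ^ v + 2 := by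
    refine hS i (2 ^ v) hi.1 hi.2 ?_ hA ?_
    · rw [him]; nlinarith
    · rw [him, cast_choose_two_pow_add_one v (by omega)]
      exact hm1
  obtain ⟨H, hH⟩ := planarQuot_comp_X_add_one (k := k) v (by omega) hm
  rw [← him] at hH
  have hT (ζ : PowerSeries k) : PowerSeries.C (f.coeff i) * Polynomial.aeval
        (PowerSeries.C (1 : k) + ζ * PowerSeries.X ^ e) (planarQuot k i) *
        PowerSeries.X ^ (d - i) = PowerSeries.X ^ (e * (2 ^ v - 1) + (d - i)) *
        (PowerSeries.C (f.coeff i) * ζ ^ (2 ^ v - 1) *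
          (1 + ζ * PowerSeries.X ^ e * Polynomial.aeval (ζ * PowerSeries.X ^ e) H)) := by
    have h := congrArg (Polynomial.aeval (ζ * PowerSeries.X ^ e)) hH
    rw [Polynomial.aeval_comp] at h
    simp only [map_add, map_mul, map_pow, map_one, Polynomial.aeval_X] at h
    rw [map_one, add_comm, h]
    ring
  by_cases hio : i = o
  · have ho' : Odd o := by
      rcases ho with h | h
      · omega
      · exact h.2.1
    have hv0 : v = 0 := by
      by_contra hv
      refine Nat.not_even_iff_odd.2 ho' (hio ▸ him ▸ ?_)
      exact (Even.pow_of_ne_zero even_two hv).mul_right m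
    have hit : i ≠ 2 * t + 4 := by
      obtain ⟨r, hr⟩ := ho'
      omega
    obtain ⟨e', rfl⟩ : ∃ e', e = e' + 1 := ⟨e - 1, by omega⟩
    rw [if_pos hio, if_neg hit]
    refine ⟨Polynomial.C (PowerSeries.C (f.coeff i)) * (Polynomial.X *
      Polynomial.C (PowerSeries.X ^ e') *
        Polynomial.aeval (Polynomial.X * Polynomial.C (PowerSeries.X ^ (e' + 1))) H), fun ζ => ?_⟩
    refine (hT ζ).trans ?_
    rw [hv0, hio]
    simp only [Polynomial.eval_mul, Polynomial.eval_C, Polynomial.eval_X,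
      eval_aeval, pow_zero, Nat.sub_self, mul_zero, zero_add, map_zero]
    ring
  by_cases hit : i = 2 * t + 4
  · have hv1 : v = 1 := by
      obtain ⟨r, hr⟩ := ht
      obtain ⟨r', hr'⟩ := hm
      rcases v with _ | _ | v
      · rw [pow_zero, one_mul] at him
        omega
      · rfl
      · have : 2 ^ (v + 1 + 1) * m = 4 * (2 ^ v * m) := by ring
        omega
    obtain ⟨e', rfl⟩ : ∃ e', e = e' + 1 := ⟨e - 1, by omega⟩
    rw [if_neg hio, if_pos hit]
    refine ⟨Polynomial.C (PowerSeries.C (f.coeff i)) * (Polynomial.X ^ 2 *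
      Polynomial.C (PowerSeries.X ^ e') *
        Polynomial.aeval (Polynomial.X * Polynomial.C (PowerSeries.X ^ (e' + 1))) H), fun ζ => ?_⟩
    refine (hT ζ).trans ?_
    rw [hv1, pow_one, show (2 - 1 : ℕ) = 1 from rfl, mul_one,
      show e' + 1 + (d - i) = d - o by omega]
    simp only [Polynomial.eval_mul, Polynomial.eval_C, Polynomial.eval_pow, Polynomial.eval_X,
      eval_aeval, map_zero]
    ring
  rw [if_neg hio, if_neg hit]
  refine HasAffineLeadingTerm.of_lt (M := e * (2 ^ v - 1) + (d - i)) ?_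
    (Polynomial.C (PowerSeries.C (f.coeff i)) * Polynomial.X ^ (2 ^ v - 1) *
      (1 + Polynomial.X * Polynomial.C (PowerSeries.X ^ e) *
        Polynomial.aeval (Polynomial.X * Polynomial.C (PowerSeries.X ^ e)) H)) fun ζ => ?_
  · obtain ⟨r, hr⟩ := ht
    obtain ⟨r', hr'⟩ := hm
    suffices i < o + e * (2 ^ v - 1) by omega
    rcases v with _ | _ | v
    · have := (hodd i ⟨r', by rw [him, pow_zero, one_mul, hr']⟩ hA).2
      omega
    · rw [zero_add, pow_one] at hle him ⊢
      omega
    · have h4 : 2 ^ (v + 1 + 1) = 4 * 2 ^ v := by ring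
      have hw : 1 ≤ 2 ^ v := Nat.one_le_two_pow
      rw [h4] at hle him ⊢
      generalize 2 ^ v = w at *
      have hmt : m ≤ t := by
        by_contra hlt
        have h5 : t + 2 ≤ m := by omega
        have := Nat.mul_le_mul_left (4 * w) h5
        nlinarith
      obtain ⟨w', rfl⟩ : ∃ w', w = w' + 1 := ⟨w - 1, by omega⟩
      have h6 : t + 2 ≤ e := by omega
      have h7 : (t + 2) * (4 * w' + 2) ≤ e * (4 * w' + 2) := Nat.mul_le_mul_right _ h6
      have h8 : 4 * (w' + 1) * m ≤ 4 * (w' + 1) * t := Nat.mul_le_mul_left _ hmt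
      rw [show 4 * (w' + 1) - 1 = 4 * w' + 2 + 1 by omega, mul_add e, mul_one]
      nlinarith
  · refine (hT ζ).trans ?_
    simp only [Polynomial.eval_mul, Polynomial.eval_C, Polynomial.eval_pow, Polynomial.eval_X,
      Polynomial.eval_add, Polynomial.eval_one, eval_aeval]

theorem coeff_two_mul_add_four_eq_zero [Fintype k] [CharP k 2] {f : Polynomial k} {d : ℕ}
    (hf : f.natDegree = d) (hd : 3 ≤ d) (hq : d ^ 4 ≤ Fintype.card k)
    (h2pow : ∀ v : ℕ, f.coeff (2 ^ v) = 0)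
    (hplanar : ∀ ε : k, ε ≠ 0 →
      Function.Injective fun x : k => f.eval (x + ε) + f.eval x + ε * x)
    {t : ℕ} (ht : Odd t)
    (hS : ∀ i j, 3 ≤ i → i ≤ d → j < i → f.coeff i ≠ 0 →
      ((((i - 1).choose j + 1 : ℕ) : k)) ≠ 0 → i ≤ (t + 1) * j + 2) :
    f.coeff (2 * t + 4) = 0 := by
  classical
  by_contra hne
  have htd : 2 * t + 4 ≤ d := hf ▸ Polynomial.le_natDegree_of_ne_zero hne
  refine hne ?_
  have hmem {i : ℕ} (hi : Odd i) (h : f.coeff i ≠ 0) : 3 ≤ i ∧ i ≤ d ∧ i ≤ t + 2 := by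
    have hid : i ≤ d := hf ▸ Polynomial.le_natDegree_of_ne_zero h
    have h1 : i ≠ 1 := by
      rintro rfl
      exact h (by simpa using h2pow 0)
    have h3 : 3 ≤ i := by
      obtain ⟨r, rfl⟩ := hi
      omega
    refine ⟨h3, hid, ?_⟩
    have := hS i 1 h3 hid (by omega) h (by
      rw [Nat.choose_one_right, Nat.sub_add_cancel (by omega), natCast_eq_one_of_odd hi]
      exact one_ne_zero)
    obtain ⟨r, rfl⟩ := hi
    obtain ⟨r', rfl⟩ := ht
    omega
  set S := (Finset.range (d + 1)).filter fun i => Odd i ∧ f.coeff i ≠ 0 with hSdef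
  rcases S.eq_empty_or_nonempty with h | h
  · refine coeff_two_mul_add_four_eq_zero_aux hf hd hq h2pow hplanar (o := 2) ht htd (Or.inl rfl)
      (by omega) (fun i hi hi0 => ?_) hS
    have : i ∈ S := Finset.mem_filter.2
      ⟨Finset.mem_range.2 (Nat.lt_succ_of_le (hmem hi hi0).2.1), hi, hi0⟩
    rw [h] at this
    exact absurd this (Finset.notMem_empty i)
  · obtain ⟨ho, ho0⟩ := (Finset.mem_filter.1 (S.max'_mem h)).2
    refine coeff_two_mul_add_four_eq_zero_aux hf hd hq h2pow hplanar (o := S.max' h) ht htd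
      (Or.inr ⟨(hmem ho ho0).1, ho, ho0⟩) (hmem ho ho0).2.2
      (fun i hi hi0 => ⟨(hmem hi hi0).1, S.le_max' i ?_⟩) hS
    exact Finset.mem_filter.2
      ⟨Finset.mem_range.2 (Nat.lt_succ_of_le (hmem hi hi0).2.1), hi, hi0⟩

/-- If the lowest-degree part after `t` blow-ups of the exponents contains a monomial whose
first exponent is `2 ^ u`, then `u ≥ 2` and the total multiplicity is `d - 2 ^ u`. -/
theorem multiplicity_eq_of_planar [Fintype k] [CharP k 2] {f : Polynomial k} {d : ℕ}
    (hf : f.natDegree = d) (hd : 3 ≤ d) (hq : d ^ 4 ≤ Fintype.card k)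
    (h2pow : ∀ v : ℕ, f.coeff (2 ^ v) = 0)
    (hplanar : ∀ ε : k, ε ≠ 0 →
      Function.Injective fun x : k => f.eval (x + ε) + f.eval x + ε * x)
    {t u N i₀ : ℕ} (ht1 : 1 ≤ t)
    (hS : ∀ i j, 3 ≤ i → i ≤ d → j < i → f.coeff i ≠ 0 →
      ((((i - 1).choose j + 1 : ℕ) : k)) ≠ 0 → i ≤ (t + 1) * j + 2)
    (hSN : ∀ i j, 3 ≤ i → i ≤ d → j < i → f.coeff i ≠ 0 →
      ((((i - 1).choose j + 1 : ℕ) : k)) ≠ 0 → N + i ≤ d + t * j)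
    (hN : N + 2 < d) (hi₀ : 3 ≤ i₀) (hi₀d : i₀ ≤ d) (hi₀A : f.coeff i₀ ≠ 0)
    (hc : ((((i₀ - 1).choose (2 ^ u) + 1 : ℕ) : k)) ≠ 0) (hNu : N + i₀ = d + t * 2 ^ u) :
    2 ≤ u ∧ N + 2 ^ u = d := by
  obtain ⟨v, m, hm, him⟩ := Nat.exists_eq_two_pow_mul_odd (n := i₀) (by omega)
  have hm3 : 3 ≤ m := by
    obtain ⟨r, rfl⟩ := hm
    rcases r with _ | r
    · exact absurd (by simpa [him] using h2pow v) hi₀A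
    · omega
  have hv1 : 1 ≤ 2 ^ v := Nat.one_le_two_pow
  have hvi : 2 ^ v < i₀ := by rw [him]; nlinarith
  have hcv : ((((i₀ - 1).choose (2 ^ v) + 1 : ℕ) : k)) ≠ 0 := by
    rw [him, cast_choose_two_pow_add_one v (by omega), natCast_eq_one_of_odd hm]
    exact one_ne_zero
  have huv : u ≤ v := by
    have h := hSN i₀ (2 ^ v) hi₀ hi₀d hvi hi₀A hcv
    have : 2 ^ u ≤ 2 ^ v := by
      by_contra hlt
      push Not at hlt
      have := Nat.mul_lt_mul_of_pos_left hlt ht1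
      omega
    exact (Nat.pow_le_pow_iff_right (by norm_num)).1 this
  obtain rfl : u = v := by
    by_contra hne
    obtain ⟨w, rfl⟩ : ∃ w, v = u + (w + 1) := ⟨v - u - 1, by omega⟩
    have h1 : i₀ = 2 ^ u * (2 * (2 ^ w * m)) := by rw [him]; ring
    rw [h1, cast_choose_two_pow_add_one u (Nat.mul_pos two_pos (Nat.mul_pos (by positivity)
      (by omega))), Nat.cast_mul, Nat.cast_two, CharTwo.two_eq_zero, zero_mul] at hc
    exact hc rfl
  have hle := hS i₀ (2 ^ u) hi₀ hi₀d hvi hi₀A hcv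
  have hlt : t * 2 ^ u + 2 < i₀ := by omega
  obtain ⟨r, hr⟩ := hm
  rcases u with _ | _ | u
  · simp only [pow_zero, one_mul, mul_one] at *
    obtain rfl : i₀ = t + 3 := by omega
    refine absurd (coeff_add_three_eq_zero hf hd hq (by simpa using h2pow 0)
      (by simpa using h2pow 1) hplanar (t := t) ?_ ht1 hi₀d fun i j h1 h2 h3 h4 h5 => ?_) hi₀A
    · rw [Nat.even_iff]; omega
    · have := hSN i j h1 h2 h3 h4 h5
      omega
  · simp only [zero_add, pow_one] at *
    obtain rfl : i₀ = 2 * t + 4 := by omega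
    refine absurd (coeff_two_mul_add_four_eq_zero hf hd hq h2pow hplanar (t := t) ?_ hS) hi₀A
    rw [Nat.odd_iff]; omega
  · refine ⟨by omega, ?_⟩
    have h4 : 4 ≤ 2 ^ (u + 1 + 1) := by
      have : 2 ^ (u + 1 + 1) = 4 * 2 ^ u := by ring
      have := Nat.one_le_two_pow (n := u)
      omega
    generalize 2 ^ (u + 1 + 1) = w at *
    have h1 : t < m := by
      by_contra h
      have := Nat.mul_le_mul_left w (not_lt.1 h)
      nlinarith
    have h2 : m < t + 2 := by
      by_contra h
      have := Nat.mul_le_mul_left w (not_lt.1 h)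
      nlinarith
    obtain rfl : m = t + 1 := by omega
    nlinarith

end Expansion

section BlowUp

variable {K : Type*} [Field K]

/-- The coefficient of `X ^ a * Y ^ b`. -/
def coeffXY (a b : ℕ) (P : MvPolynomial (Fin 2) K) : K :=
  P.coeff (Finsupp.single (0 : Fin 2) a + Finsupp.single (1 : Fin 2) b)

theorem single_add_single_inj {a b a' b' : ℕ} :
    Finsupp.single (0 : Fin 2) a + Finsupp.single (1 : Fin 2) b =
      Finsupp.single (0 : Fin 2) a' + Finsupp.single (1 : Fin 2) b' ↔ a = a' ∧ b = b' := by
  constructor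
  · intro h
    have h0 := DFunLike.congr_fun h 0
    have h1 := DFunLike.congr_fun h 1
    simp at h0 h1
    exact ⟨h0, h1⟩
  · rintro ⟨rfl, rfl⟩
    rfl

theorem eq_single_add_single (m : Fin 2 →₀ ℕ) :
    m = Finsupp.single (0 : Fin 2) (m 0) + Finsupp.single (1 : Fin 2) (m 1) := by
  ext i
  fin_cases i <;> simp

theorem sum_single_add_single (a b : ℕ) :
    ((Finsupp.single (0 : Fin 2) a + Finsupp.single (1 : Fin 2) b).sum fun _ e => e) = a + b := by
  rw [Finsupp.sum_fintype _ _ fun _ => rfl]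
  simp [Fin.sum_univ_two]

theorem X_zero_dvd_iff {P : MvPolynomial (Fin 2) K} :
    X 0 ∣ P ↔ ∀ b, coeffXY 0 b P = 0 := by
  constructor
  · rintro ⟨Q, rfl⟩ b
    rw [coeffXY, coeff_X_mul', if_neg]
    simp
  · intro h
    rw [P.as_sum]
    refine Finset.dvd_sum fun m hm => X_dvd_monomial.2 ?_
    by_contra hne
    push Not at hne
    have := h (m 1)
    rw [coeffXY, ← hne.2, ← eq_single_add_single] at this
    exact hne.1 this

theorem coeffXY_mul_X_pow (a b n : ℕ) (P : MvPolynomial (Fin 2) K) :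
    coeffXY a (b + n) (P * X 1 ^ n) = coeffXY a b P := by
  rw [coeffXY, Finsupp.single_add, ← add_assoc, X_pow_eq_monomial, coeff_mul_monomial, mul_one]
  rfl

theorem coeffXY_monomial (a b a' b' : ℕ) (c : K) :
    coeffXY a b (monomial (Finsupp.single (0 : Fin 2) a' + Finsupp.single (1 : Fin 2) b') c) =
      if a' = a ∧ b' = b then c else 0 := by
  classical
  rw [coeffXY, coeff_monomial]
  simp only [single_add_single_inj]

theorem coeffXY_aeval_blowUp (a b : ℕ) (P : MvPolynomial (Fin 2) K) :
    coeffXY a b (aeval ![X 0 * X 1, X 1] P) = if a ≤ b then coeffXY a (b - a) P else 0 := by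
  induction P using MvPolynomial.induction_on' with
  | monomial m c =>
    rw [eq_single_add_single m, coeffXY_monomial]
    have : (aeval ![X 0 * X 1, X 1]) (monomial (Finsupp.single (0 : Fin 2) (m 0) +
        Finsupp.single (1 : Fin 2) (m 1)) c) = monomial (Finsupp.single (0 : Fin 2) (m 0) +
        Finsupp.single (1 : Fin 2) (m 0 + m 1)) c := by
      rw [aeval_monomial, Finsupp.prod_fintype _ _ fun _ => pow_zero _, Fin.prod_univ_two,
        monomial_eq, Finsupp.prod_fintype _ _ fun _ => pow_zero _, Fin.prod_univ_two]
      simp only [algebraMap_eq, Matrix.cons_val_zero, Matrix.cons_val_one, Finsupp.add_apply,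
        Finsupp.single_apply, Fin.isValue, mul_pow, if_true, one_ne_zero, zero_ne_one, if_false,
        add_zero, zero_add, pow_add]
      ring
    rw [this, coeffXY_monomial, ← ite_and]
    refine if_congr ?_ rfl rfl
    omega
  | add P Q hP hQ =>
    have hadd (a b : ℕ) (P Q : MvPolynomial (Fin 2) K) :
        coeffXY a b (P + Q) = coeffXY a b P + coeffXY a b Q := coeff_add _ _ _
    rw [map_add, hadd, hP, hQ]
    split_ifs
    · rw [hadd]
    · rw [add_zero]

theorem mem_degrees_iff {P : MvPolynomial (Fin 2) K} {m : ℕ} :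
    (∃ s ∈ P.support, (s.sum fun _ e => e) = m) ↔ ∃ a b, a + b = m ∧ coeffXY a b P ≠ 0 := by
  constructor
  · rintro ⟨s, hs, rfl⟩
    rw [eq_single_add_single s] at hs ⊢
    exact ⟨s 0, s 1, (sum_single_add_single _ _).symm, mem_support_iff.1 hs⟩
  · rintro ⟨a, b, rfl, h⟩
    exact ⟨_, mem_support_iff.2 h, sum_single_add_single a b⟩

theorem coeffXY_tangentCone {P : MvPolynomial (Fin 2) K} {n : ℕ}
    (hn : IsLeast {m : ℕ | ∃ s ∈ P.support, (s.sum fun _ e => e) = m} n) (a b : ℕ) :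
    coeffXY a b (tangentCone P) = if a + b = n then coeffXY a b P else 0 := by
  rw [tangentCone, minMonomialDeg, hn.csInf_eq, coeffXY, coeff_homogeneousComponent,
    Finsupp.degree_eq_sum]
  simp [Fin.sum_univ_two, coeffXY]

/-- The support of an iterated blow-up in terms of the support of the initial polynomial. -/
theorem coeffXY_iterated_blowUp {F : ℕ → MvPolynomial (Fin 2) K} {nseq : ℕ → ℕ}
    (hnseq : ∀ r : ℕ, 1 ≤ r →
      IsLeast {m : ℕ | ∃ s ∈ (F (r - 1)).support, (s.sum fun _ e => e) = m} (nseq r))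
    (hFr : ∀ r : ℕ, 1 ≤ r →
      F r * (X 1 : MvPolynomial (Fin 2) K) ^ (nseq r) = aeval ![X 0 * X 1, X 1] (F (r - 1)))
    (r : ℕ) :
    (∀ a b, coeffXY a b (F r) ≠ 0 ↔
      ∃ c, c + r * a = b + ∑ s ∈ Finset.Icc 1 r, nseq s ∧ coeffXY a c (F 0) ≠ 0) ∧
    ∀ a c, coeffXY a c (F 0) ≠ 0 → ∑ s ∈ Finset.Icc 1 r, nseq s ≤ c + r * a := by
  induction r with
  | zero => simp
  | succ r ih =>
    obtain ⟨ih1, ih2⟩ := ih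
    have hle := (hnseq (r + 1) (by omega)).2
    have hF := hFr (r + 1) (by omega)
    rw [Nat.add_sub_cancel] at hle hF
    rw [Finset.sum_Icc_succ_top (by omega)]
    have hstep (a b : ℕ) : coeffXY a b (F (r + 1)) =
        if a ≤ b + nseq (r + 1) then coeffXY a (b + nseq (r + 1) - a) (F r) else 0 := by
      rw [← coeffXY_mul_X_pow a b (nseq (r + 1)), hF, coeffXY_aeval_blowUp]
    constructor
    · intro a b
      rw [hstep]
      constructor
      · intro h
        split_ifs at h with hab
        · obtain ⟨c, hc, h0⟩ := (ih1 _ _).1 h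
          refine ⟨c, ?_, h0⟩
          rw [add_mul, one_mul]
          omega
        · exact absurd rfl h
      · rintro ⟨c, hc, h0⟩
        have := ih2 a c h0
        rw [add_mul, one_mul] at hc
        rw [if_pos (by omega)]
        exact (ih1 _ _).2 ⟨c, by omega, h0⟩
    · intro a c h0
      have h1 := ih2 a c h0
      have h2 := hle (mem_degrees_iff.2 ⟨a, c + r * a - ∑ s ∈ Finset.Icc 1 r, nseq s, rfl,
        (ih1 _ _).2 ⟨c, by omega, h0⟩⟩)
      rw [add_mul, one_mul]
      omega

theorem coeffXY_initial_ne_zero_iff [CharP K 2] {A : ℕ → K} {d : ℕ} (hd : 3 ≤ d) (a c : ℕ) :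
    coeffXY a c ((X 1 : MvPolynomial (Fin 2) K) ^ (d - 2) +
      ∑ i ∈ Finset.Icc 3 d, C (A i) * (X 1) ^ (d - i) *
        ∑ k ∈ Finset.range i, C ((((i - 1).choose k + 1 : ℕ) : K)) * (X 0) ^ k) ≠ 0 ↔
    (a = 0 ∧ c = d - 2) ∨ ∃ i, 3 ≤ i ∧ i ≤ d ∧ c = d - i ∧ a < i ∧ A i ≠ 0 ∧
      ((((i - 1).choose a + 1 : ℕ) : K)) ≠ 0 := by
  have hexp : coeffXY a c ((X 1 : MvPolynomial (Fin 2) K) ^ (d - 2) +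
      ∑ i ∈ Finset.Icc 3 d, C (A i) * (X 1) ^ (d - i) *
        ∑ k ∈ Finset.range i, C ((((i - 1).choose k + 1 : ℕ) : K)) * (X 0) ^ k) =
      (if 0 = a ∧ d - 2 = c then 1 else 0) + ∑ i ∈ Finset.Icc 3 d,
        ∑ k ∈ Finset.range i, if k = a ∧ d - i = c then A i * (((i - 1).choose k + 1 : ℕ) : K)
          else 0 := by
    rw [coeffXY, coeff_add, coeff_sum]
    congr 1
    · have : (X 1 : MvPolynomial (Fin 2) K) ^ (d - 2) =
          monomial (Finsupp.single (0 : Fin 2) 0 + Finsupp.single (1 : Fin 2) (d - 2)) 1 := by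
        rw [X_pow_eq_monomial, Finsupp.single_zero, zero_add]
      rw [this]
      exact coeffXY_monomial _ _ _ _ _
    · refine Finset.sum_congr rfl fun i _ => ?_
      rw [Finset.mul_sum, coeff_sum]
      refine Finset.sum_congr rfl fun k _ => ?_
      have : C (A i) * (X 1) ^ (d - i) * (C ((((i - 1).choose k + 1 : ℕ) : K)) * (X 0) ^ k) =
          monomial (Finsupp.single (0 : Fin 2) k + Finsupp.single (1 : Fin 2) (d - i))
            (A i * (((i - 1).choose k + 1 : ℕ) : K)) := by
        rw [X_pow_eq_monomial, X_pow_eq_monomial, C_mul_monomial, C_mul_monomial, monomial_mul,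
          mul_one, mul_one, add_comm]
      rw [this]
      exact coeffXY_monomial _ _ _ _ _
  rw [hexp]
  constructor
  · intro h
    by_contra hnot
    push Not at hnot
    refine h ?_
    rw [if_neg (by rintro ⟨h1, h2⟩; exact hnot.1 h1.symm h2.symm), zero_add]
    refine Finset.sum_eq_zero fun i hi => Finset.sum_eq_zero fun k hk => ?_
    rw [Finset.mem_Icc] at hi
    rw [Finset.mem_range] at hk
    split_ifs with h1
    · obtain ⟨rfl, h1⟩ := h1
      by_cases hA : A i = 0
      · rw [hA, zero_mul]
      · rw [hnot.2 i hi.1 hi.2 h1.symm hk hA, mul_zero]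
    · rfl
  · rintro (⟨rfl, rfl⟩ | ⟨i, h3, hid, rfl, hai, hA, hc⟩)
    · rw [if_pos ⟨rfl, rfl⟩, Finset.sum_eq_zero, add_zero]
      · exact one_ne_zero
      · intro i hi
        rw [Finset.mem_Icc] at hi
        exact Finset.sum_eq_zero fun k _ => if_neg (by omega)
    · rw [if_neg (by omega), zero_add, Finset.sum_eq_single_of_mem i (Finset.mem_Icc.2 ⟨h3, hid⟩),
        Finset.sum_eq_single_of_mem a (Finset.mem_range.2 hai), if_pos ⟨rfl, rfl⟩]
      · exact mul_ne_zero hA hc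
      · exact fun k _ hk => if_neg fun h => hk h.1
      · intro i' hi' hne
        rw [Finset.mem_Icc] at hi'
        exact Finset.sum_eq_zero fun k _ => if_neg (by omega)

end BlowUp

theorem images_of_monomials
    {K : Type*} [Field K] [Fintype K] (n : ℕ) (hn : 1 ≤ n)
    (hcard : Fintype.card K = 2 ^ n)
    (f : Polynomial K) (d : ℕ) (hd : f.natDegree = d) (hd3 : 3 ≤ d)
    (hAd : f.coeff d ≠ 0)
    (hdeg : d ^ 4 ≤ Fintype.card K)
    (h2pow : ∀ i k : ℕ, i = 2 ^ k → f.coeff i = 0)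
    (hplanar : ∀ ε : K, ε ≠ 0 →
      Function.Bijective fun x : K => f.eval (x + ε) + f.eval x + ε * x)
    (F : ℕ → MvPolynomial (Fin 2) K) (nseq : ℕ → ℕ)
    (hF0 : F 0 = (X 1 : MvPolynomial (Fin 2) K) ^ (d - 2) +
      ∑ i ∈ Finset.Icc 3 d, C (f.coeff i) * (X 1) ^ (d - i) *
        ∑ k ∈ Finset.range i, C ((((i - 1).choose k + 1 : ℕ) : K)) * (X 0) ^ k)
    (hnseq : ∀ r : ℕ, 1 ≤ r →
      IsLeast {m : ℕ | ∃ s ∈ (F (r - 1)).support, (s.sum fun _ e => e) = m} (nseq r))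
    (hFr : ∀ r : ℕ, 1 ≤ r →
      F r * (X 1 : MvPolynomial (Fin 2) K) ^ (nseq r) = aeval ![X 0 * X 1, X 1] (F (r - 1)))
    (t : ℕ) (ht1 : 1 ≤ t)
    (ht : ¬ (X 0 : MvPolynomial (Fin 2) K) ∣ tangentCone (F t))
    (htleast : ∀ s : ℕ, s < t → (X 0 : MvPolynomial (Fin 2) K) ∣ tangentCone (F s))
    (u : ℕ)
    (hu : IsLeast {u' : ℕ | ∃ ℓ : ℕ,
      (tangentCone (F (t - 1))).coeff
        (Finsupp.single (0 : Fin 2) (2 ^ u') + Finsupp.single (1 : Fin 2) ℓ) ≠ 0} u)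
    (Ft1 Ft2 : MvPolynomial (Fin 2) K)
    (hFt1 : Ft1 * (X 0 : MvPolynomial (Fin 2) K) ^ (2 ^ u - 2) = aeval ![X 0, X 0 * X 1] (F t))
    (hFt2 : Ft2 * (X 1 : MvPolynomial (Fin 2) K) ^ (2 ^ u - 4) =
      aeval ![X 0 * (X 1) ^ (2 ^ (u - 1) - 2), X 1] Ft1)
    :
    (∑ r ∈ Finset.Icc 1 t, (nseq r : ℤ)) = (d : ℤ) - 2 ^ u ∧
    ∀ k i : ℕ, i ≤ d →
      (F 0).coeff (Finsupp.single (0 : Fin 2) k + Finsupp.single (1 : Fin 2) (d - i)) ≠ 0 →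
      (fun p : ℤ × ℤ => (p.1, (2 ^ (u - 1) - 2) * p.1 + p.2 - (2 ^ u - 4)))
        ((fun p : ℤ × ℤ => (p.1 + p.2 - (2 ^ u - 2), p.2))
          ((fun p : ℤ × ℤ => (p.1, p.1 * (t : ℤ) + p.2 - ((d : ℤ) - 2 ^ u)))
            ((k : ℤ), (d : ℤ) - (i : ℤ)))) =
      ((k : ℤ) * ((t : ℤ) + 1) - (i : ℤ) + 2,
       (k : ℤ) * (2 ^ (u - 1) * ((t : ℤ) + 1) - (t : ℤ) - 2)
         - (i : ℤ) * (2 ^ (u - 1) - 1) + 2 ^ u) := by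
  have : CharP K 2 := charP_of_card_eq_prime_pow hcard
  have hblow := coeffXY_iterated_blowUp hnseq hFr
  have hinit (a c : ℕ) := coeffXY_initial_ne_zero_iff (A := fun i => f.coeff i) hd3 a c
  rw [← hF0] at hinit
  have hN1 : (∑ s ∈ Finset.Icc 1 (t + 1), nseq s) = d - 2 := by
    rw [X_zero_dvd_iff] at ht
    push Not at ht
    obtain ⟨b, hb⟩ := ht
    have hl := hnseq (t + 1) (by omega)
    rw [Nat.add_sub_cancel] at hl
    rw [coeffXY_tangentCone hl] at hb
    split_ifs at hb with hbn
    · obtain ⟨c, hc, h0⟩ := ((hblow t).1 0 b).1 hb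
      obtain ⟨_, rfl⟩ | ⟨i, h3, hid, _, _, _, h⟩ := (hinit 0 c).1 h0
      · rw [Finset.sum_Icc_succ_top (by omega)]
        omega
      · rw [Nat.choose_zero_right, Nat.cast_add, Nat.cast_one, CharTwo.add_self_eq_zero] at h
        exact absurd rfl h
    · exact absurd rfl hb
  obtain ⟨t, rfl⟩ : ∃ t', t = t' + 1 := ⟨t - 1, by omega⟩
  have hl := hnseq (t + 1) (by omega)
  rw [Nat.add_sub_cancel] at hl hu
  have hNt := Finset.sum_Icc_succ_top (show 1 ≤ t + 1 by omega) nseq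
  have hN : (∑ s ∈ Finset.Icc 1 (t + 1), nseq s) + 2 < d := by
    have h0 := (hinit 0 (d - 2)).2 (Or.inl ⟨rfl, rfl⟩)
    have h1 := (hblow t).2 _ _ h0
    have h2 := ((hblow t).1 0 (d - 2 - ∑ s ∈ Finset.Icc 1 t, nseq s)).2
      ⟨d - 2, by omega, h0⟩
    have h3 := hl.2 (mem_degrees_iff.2 ⟨_, _, rfl, h2⟩)
    have h4 := X_zero_dvd_iff.1 (htleast t (Nat.lt_succ_self t))
      (d - 2 - ∑ s ∈ Finset.Icc 1 t, nseq s)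
    rw [coeffXY_tangentCone hl] at h4
    split_ifs at h4 with h5
    · exact absurd h4 h2
    · omega
  have hne {i j : ℕ} (h3 : 3 ≤ i) (hid : i ≤ d) (hji : j < i) (hA : f.coeff i ≠ 0)
      (hc : ((((i - 1).choose j + 1 : ℕ) : K)) ≠ 0) : coeffXY j (d - i) (F 0) ≠ 0 :=
    (hinit j (d - i)).2 (Or.inr ⟨i, h3, hid, rfl, hji, hA, hc⟩)
  obtain ⟨ℓ, hℓ⟩ := hu.1
  change coeffXY (2 ^ u) ℓ (tangentCone (F t)) ≠ 0 at hℓ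
  rw [coeffXY_tangentCone hl] at hℓ
  split_ifs at hℓ with hdeg'
  swap
  · exact absurd rfl hℓ
  obtain ⟨c, hc, h0⟩ := ((hblow t).1 _ _).1 hℓ
  have hu1 : 1 ≤ 2 ^ u := Nat.one_le_two_pow
  obtain ⟨h, _⟩ | ⟨i, hi3, hid, rfl, hui, hiA, hic⟩ := (hinit _ c).1 h0
  · omega
  obtain ⟨hu2, hNd⟩ := multiplicity_eq_of_planar hd hd3 hdeg (fun v => h2pow _ v rfl)
    (fun ε hε => (hplanar ε hε).injective) ht1
    (fun i j h3 hid hji hA hc => by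
      have := (hblow (t + 1 + 1)).2 _ _ (hne h3 hid hji hA hc)
      rw [hN1] at this
      omega)
    (N := ∑ s ∈ Finset.Icc 1 (t + 1), nseq s)
    (fun i j h3 hid hji hA hc => by
      have := (hblow (t + 1)).2 _ _ (hne h3 hid hji hA hc)
      omega) hN hi3 hid hiA hic (by rw [add_mul, one_mul]; omega)
  constructor
  · rw [← hNd]
    push_cast
    ring
  · intro k i _ _
    obtain ⟨u, rfl⟩ : ∃ u', u = u' + 1 := ⟨u - 1, by omega⟩
    simp only [Nat.add_sub_cancel, Prod.mk.injEq, pow_succ]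
    push_cast
    constructor <;> ring
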